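/- arXiv:1702.00558 — 4 statements merged into one kernel-verified Lean document; each statement's English description precedes it below -/
import Mathlib

section
/- Let q be a prime power and r an odd prime not dividing q. Let A = F_q[Y]/⟨1 + Y + ··· + Y^{r-1}⟩, let ζ ∈ A be the residue class of Y, let e be the multiplicative order of q modulo r, and write q^e - 1 = u·r^t with r not dividing u and t ≥ 1. Suppose ρ : (ℤ/rℤ)* → Aut_{F_q-alg}(A) is a group homomorphism with ρ_a(ζ) = ζ^a for every a ∈ (ℤ/rℤ)*. For an integer a coprime to r let ω(a) be an integer with ω(a) ≡ a^{r^{t-1}} (mod r^t). Suppose δ ∈ A* satisfies δ^{r^{t-1}} = ζ^{-1}, and define c = ∏_{a=1}^{r-1} ρ_a^{-1}(δ^{ω(a)}). Then: (1) c^{r^{t-1}} = ζ; (2) c has multiplicative order exactly r^t in A*; and (3) ρ_b(c) = c^{ω(b)} for every b ∈ (ℤ/rℤ)*. -/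
open Polynomial

/-- The ring `A = F[Y]/⟨1 + Y + ⋯ + Y^(r-1)⟩`. -/
abbrev cycRing (F : Type*) [Field F] (r : ℕ) : Type _ :=
  AdjoinRoot (∑ i ∈ Finset.range r, (Polynomial.X : Polynomial F) ^ i)

/-- The residue class `ζ` of `Y` in `A = F[Y]/⟨1 + Y + ⋯ + Y^(r-1)⟩`. -/
noncomputable def cycZeta (F : Type*) [Field F] (r : ℕ) : cycRing F r :=
  AdjoinRoot.root _

/-- The residue class `ζ` satisfies `ζ ^ r = 1`. -/
theorem cycZeta_pow_eq_one (F : Type*) [Field F] (r : ℕ) : cycZeta F r ^ r = 1 := by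
  have h : ∑ i ∈ Finset.range r, cycZeta F r ^ i = 0 := by
    have := AdjoinRoot.eval₂_root (∑ i ∈ Finset.range r, (X : F[X]) ^ i)
    simpa [eval₂_finsetSum, cycZeta] using this
  rw [← sub_eq_zero, ← geom_sum_mul, h, zero_mul]

/-- For `r ≥ 3` the residue class `ζ` is not `1`. -/
theorem cycZeta_ne_one (F : Type*) [Field F] {r : ℕ} (hr : 3 ≤ r) : cycZeta F r ≠ 1 := by
  intro h
  have h0 : AdjoinRoot.mk (∑ i ∈ Finset.range r, (X : F[X]) ^ i) (X - C 1) = 0 := by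
    rw [map_sub, AdjoinRoot.mk_X, C_1, map_one]
    exact sub_eq_zero.mpr h
  have hdvd := AdjoinRoot.mk_eq_zero.mp h0
  have hdeg := natDegree_le_of_dvd hdvd (X_sub_C_ne_zero 1)
  rw [natDegree_X_sub_C] at hdeg
  have hcoeff : (∑ i ∈ Finset.range r, (X : F[X]) ^ i).coeff (r - 1) = 1 := by
    simp [coeff_X_pow, show 0 < r by lia]
  have := le_natDegree_of_ne_zero (p := ∑ i ∈ Finset.range r, (X : F[X]) ^ i) (n := r - 1)
    (by rw [hcoeff]; exact one_ne_zero)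
  lia

/-- Natural numbers congruent modulo `r` have `r ^ k`-th powers congruent modulo
`r ^ (k + 1)`. -/
theorem Nat.ModEq.pow_prime_pow {r a b : ℕ} (h : a ≡ b [MOD r]) (k : ℕ) :
    a ^ r ^ k ≡ b ^ r ^ k [MOD r ^ (k + 1)] := by
  rw [Nat.modEq_iff_dvd] at h ⊢
  exact_mod_cast dvd_sub_pow_of_dvd_sub h k

/-- Let `F` be a finite field with `q` elements, `r` an odd prime not
dividing `q`, `A = F[Y]/⟨1 + Y + ⋯ + Y^(r-1)⟩` with `ζ ∈ A` the residue class of `Y`, `e`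
the multiplicative order of `q` modulo `r`, and write `q^e - 1 = u·r^t` with `r ∤ u`,
`t ≥ 1`.  Let `ρ : (ℤ/rℤ)* → Aut_{F-alg}(A)` be a group homomorphism with `ρ_a(ζ) = ζ^a`
for all `a`, and for `a` coprime to `r` let `ω(a)` satisfy
`ω(a) ≡ a^{r^(t-1)} (mod r^t)`.  Suppose `δ ∈ A` satisfies `δ^{r^(t-1)} = ζ⁻¹`, i.e.
`δ^{r^(t-1)} · ζ = 1`, and set `c = ∏_{a ∈ (ℤ/rℤ)*} ρ_a⁻¹(δ^{ω(a)})`.  Then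
(1) `c^{r^(t-1)} = ζ`; (2) `c` has multiplicative order exactly `r^t`; and
(3) `ρ_b(c) = c^{ω(b)}` for every `b ∈ (ℤ/rℤ)*`. -/
theorem teichmueller_generator (q r e u t : ℕ) [NeZero r] (F : Type*) [Field F] [Fintype F]
    (hq : Fintype.card F = q) (hr : r.Prime) (hodd : Odd r) (hrq : ¬ r ∣ q)
    (he : e = orderOf (q : ZMod r))
    (hut : q ^ e - 1 = u * r ^ t) (hu : ¬ r ∣ u) (ht : 1 ≤ t)
    (ρ : (ZMod r)ˣ →* (cycRing F r ≃ₐ[F] cycRing F r))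
    (hρ : ∀ a : (ZMod r)ˣ, ρ a (cycZeta F r) = cycZeta F r ^ ((a : ZMod r).val))
    (ω : ℕ → ℕ) (hω : ∀ a : ℕ, Nat.Coprime a r → ω a ≡ a ^ r ^ (t - 1) [MOD r ^ t])
    (δ : cycRing F r) (hδ : δ ^ r ^ (t - 1) * cycZeta F r = 1)
    (c : cycRing F r)
    (hc : c = ∏ a : (ZMod r)ˣ, (ρ a).symm (δ ^ ω ((a : ZMod r).val))) :
    c ^ r ^ (t - 1) = cycZeta F r ∧
    orderOf c = r ^ t ∧
    ∀ b : (ZMod r)ˣ, ρ b c = c ^ ω ((b : ZMod r).val) := by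
  have : Fact r.Prime := ⟨hr⟩
  obtain ⟨k, rfl⟩ : ∃ k, t = k + 1 := ⟨t - 1, by lia⟩
  simp only [Nat.add_sub_cancel] at hω hδ ⊢
  have hr3 : 3 ≤ r := by
    have := hr.two_le
    obtain ⟨m, rfl⟩ := hodd
    lia
  have hζ := cycZeta_pow_eq_one F r
  have hcop (a : (ZMod r)ˣ) : Nat.Coprime (a : ZMod r).val r := ZMod.val_coe_unit_coprime a
  have hδ1 : δ ^ r ^ (k + 1) = 1 := by
    have := congrArg (· ^ r) hδ
    simpa [mul_pow, hζ, ← pow_mul, ← pow_succ] using this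
  have hωr (a : (ZMod r)ˣ) : ω (a : ZMod r).val ≡ (a : ZMod r).val [MOD r] := by
    refine ((hω _ (hcop a)).of_dvd (dvd_pow_self r k.succ_ne_zero)).trans ?_
    rw [← ZMod.natCast_eq_natCast_iff]
    simp [ZMod.pow_card_pow]
  have hωmul (a b : (ZMod r)ˣ) : ω ((b * a : (ZMod r)ˣ) : ZMod r).val ≡
      ω (a : ZMod r).val * ω (b : ZMod r).val [MOD r ^ (k + 1)] := by
    refine (hω _ (hcop _)).trans (.trans ?_ ((hω _ (hcop a)).mul (hω _ (hcop b))).symm)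
    rw [← mul_pow]
    refine Nat.ModEq.pow_prime_pow ?_ k
    rw [← ZMod.natCast_eq_natCast_iff]
    simp [mul_comm]
  have h1 : c ^ r ^ k = cycZeta F r := by
    have hfac (a : (ZMod r)ˣ) :
        (ρ a).symm (δ ^ ω (a : ZMod r).val) ^ r ^ k * cycZeta F r = 1 := by
      apply (ρ a).injective
      rw [map_mul, map_pow, AlgEquiv.apply_symm_apply, hρ, map_one,
        ← pow_eq_pow_of_modEq (hωr a) hζ, pow_right_comm, ← mul_pow, hδ, one_pow]
    have hprod : c ^ r ^ k * cycZeta F r ^ (r - 1) = 1 := by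
      have := Finset.prod_congr rfl fun a (_ : a ∈ Finset.univ) => hfac a
      rw [Finset.prod_mul_distrib, Finset.prod_pow, ← hc] at this
      simpa [ZMod.card_units_eq_totient, Nat.totient_prime hr] using this
    calc c ^ r ^ k = c ^ r ^ k * cycZeta F r ^ r := by rw [hζ, mul_one]
      _ = c ^ r ^ k * cycZeta F r ^ (r - 1) * cycZeta F r := by
        rw [mul_assoc, ← pow_succ, Nat.sub_add_cancel hr.one_le]
      _ = cycZeta F r := by rw [hprod, one_mul]
  refine ⟨h1, orderOf_eq_prime_pow ?_ ?_, fun b => ?_⟩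
  · rw [h1]
    exact cycZeta_ne_one F hr3
  · rw [pow_succ, pow_mul, h1, hζ]
  · rw [hc, map_prod, ← Finset.prod_pow, ← Equiv.prod_comp (Equiv.mulLeft b)]
    refine Finset.prod_congr rfl fun a _ => ?_
    have hρsymm (x : (ZMod r)ˣ) : (ρ x).symm = ρ x⁻¹ := (map_inv ρ x).symm
    rw [Equiv.coe_mulLeft, hρsymm, hρsymm, ← AlgEquiv.mul_apply, ← map_mul, mul_inv_rev,
      mul_comm a⁻¹, mul_inv_cancel_left, pow_eq_pow_of_modEq (hωmul a b) hδ1,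
      pow_mul, map_pow]
end

section
/- Let q be a prime power with 4 | q-1, let f ∈ F_q[x] be a monic irreducible polynomial of even degree d, let K = F_q[x]/⟨f⟩ and let α ∈ K be the residue class of x. Then f'(α), the formal derivative of f evaluated at α, is a quadratic nonresidue in K, i.e. f'(α)^{(q^d-1)/2} ≠ 1. -/
open Polynomial

namespace FiniteField

variable {F K : Type*} [Field F] [Fintype F] [Field K] [Finite K] [Algebra F K]

/-- The matrix of conjugates of a family `b`, whose `(i, k)` entry is `b i ^ q ^ k`, where `q` is
the cardinality of the base field `F`. -/
def frobeniusMatrix (F : Type*) [Fintype F] {K : Type*} [Monoid K] {n : ℕ} (b : Fin n → K) :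
    Matrix (Fin n) (Fin n) K :=
  .of fun i k ↦ b i ^ Fintype.card F ^ (k : ℕ)

theorem map_traceMatrix_eq_frobeniusMatrix_mul_transpose {n : ℕ}
    (hn : Module.finrank F K = n) (b : Fin n → K) :
    (Algebra.traceMatrix F b).map (algebraMap F K) =
      frobeniusMatrix F b * (frobeniusMatrix F b).transpose := by
  ext i j
  simp [Matrix.mul_apply, frobeniusMatrix, Algebra.traceMatrix_apply, Algebra.traceForm_apply,
    algebraMap_trace_eq_sum_pow, hn, Finset.sum_range, mul_pow]

theorem algebraMap_discr_eq_det_frobeniusMatrix_sq {n : ℕ}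
    (hn : Module.finrank F K = n) (b : Fin n → K) :
    algebraMap F K (Algebra.discr F b) = (frobeniusMatrix F b).det ^ 2 := by
  rw [Algebra.discr_def, RingHom.map_det, RingHom.mapMatrix_apply,
    map_traceMatrix_eq_frobeniusMatrix_mul_transpose hn, Matrix.det_mul, Matrix.det_transpose, sq]

/-- Frobenius rotates the columns of the matrix of conjugates. -/
theorem det_frobeniusMatrix_pow_card {n : ℕ} (hn : Module.finrank F K = n) (b : Fin n → K) :
    (frobeniusMatrix F b).det ^ Fintype.card F = (-1) ^ (n - 1) * (frobeniusMatrix F b).det := by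
  have hrot : (frobeniusAlgHom F K).toRingHom.mapMatrix (frobeniusMatrix F b) =
      (frobeniusMatrix F b).submatrix id (finRotate n) := by
    ext i k
    simp only [frobeniusMatrix, RingHom.mapMatrix_apply, Matrix.map_apply, Matrix.of_apply,
      Matrix.submatrix_apply, id, AlgHom.toRingHom_eq_coe, RingHom.coe_coe,
      coe_frobeniusAlgHom, ← pow_mul, ← pow_succ]
    obtain _ | n := n
    · exact k.elim0
    obtain h | h := eq_or_ne k (Fin.last n)
    · subst h
      have := Fintype.ofFinite K
      have hcard : Fintype.card F ^ (n + 1) = Fintype.card K := by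
        rw [Module.card_eq_pow_finrank (K := F) (V := K), hn]
      simp [hcard, pow_card]
    · rw [coe_finRotate_of_ne_last h]
  have := congrArg Matrix.det hrot
  rwa [← RingHom.map_det, Matrix.det_permute', sign_finRotate, AlgHom.toRingHom_eq_coe,
    RingHom.coe_coe, coe_frobeniusAlgHom, Units.val_pow_eq_pow_val, Units.val_neg, Units.val_one,
    Int.cast_pow, Int.cast_neg, Int.cast_one] at this

/-- **Stickelberger's theorem** on the quadratic character of the discriminant of an extension of
finite fields. -/
theorem discr_pow_card_sub_one_div_two (hF : Odd (Fintype.card F)) {n : ℕ}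
    (b : Module.Basis (Fin n) F K) :
    Algebra.discr F b ^ ((Fintype.card F - 1) / 2) = (-1) ^ (n - 1) := by
  have hn : Module.finrank F K = n := by simp [Module.finrank_eq_card_basis b]
  have hsq := algebraMap_discr_eq_det_frobeniusMatrix_sq hn b
  have hne : (frobeniusMatrix F b).det ≠ 0 := by
    intro h
    rw [h, zero_pow two_ne_zero, map_eq_zero] at hsq
    exact Algebra.discr_not_zero_of_basis F b hsq
  apply (algebraMap F K).injective
  rw [map_pow, hsq, ← pow_mul, Nat.mul_div_cancel' (by obtain ⟨k, hk⟩ := hF; omega)]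
  apply mul_right_cancel₀ hne
  rw [← pow_succ, Nat.sub_add_cancel Fintype.card_pos, det_frobeniusMatrix_pow_card hn]
  simp

end FiniteField

/-- Let `F` be a finite field with `q` elements where `4 ∣ q - 1`, let
`f ∈ F[x]` be a monic irreducible polynomial of even degree `d`, let `K = F[x]/⟨f⟩` and
let `α ∈ K` be the residue class of `x`.  Then `f'(α)`, the formal derivative of `f`
evaluated at `α`, is a quadratic nonresidue in `K`, i.e. `f'(α) ^ ((q^d - 1)/2) ≠ 1`. -/
theorem derivative_at_root_nonresidue (q d : ℕ) (F : Type*) [Field F] [Fintype F]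
    (hq : Fintype.card F = q) (h4 : 4 ∣ q - 1)
    (f : Polynomial F) (hmonic : f.Monic) (hirr : Irreducible f)
    (hdeg : f.natDegree = d) (hd : Even d) :
    (AdjoinRoot.mk f (Polynomial.derivative f)) ^ ((q ^ d - 1) / 2) ≠ 1 := by
  subst hq hdeg
  have := Fact.mk hirr
  let pb := AdjoinRoot.powerBasis hirr.ne_zero
  have hfin : Module.Finite F (AdjoinRoot f) := pb.finite
  have : Finite (AdjoinRoot f) := Module.finite_of_finite F
  have := Fintype.ofFinite (AdjoinRoot f)
  have hrank : Module.finrank F (AdjoinRoot f) = f.natDegree := pb.finrank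
  have hcard : Nat.card (AdjoinRoot f) = Fintype.card F ^ f.natDegree := by
    rw [Nat.card_eq_fintype_card, Module.card_eq_pow_finrank (K := F), hrank]
  have hone : 1 < Fintype.card F := Fintype.one_lt_card
  have hF : Odd (Fintype.card F) := by
    obtain ⟨k, hk⟩ := h4
    exact ⟨2 * k, by omega⟩
  have heven : Even ((Fintype.card F - 1) / 2) := by
    obtain ⟨k, hk⟩ := h4
    exact ⟨k, by omega⟩
  have hexp : (Fintype.card F ^ f.natDegree - 1) / 2 =
      (Fintype.card F ^ f.natDegree - 1) / (Fintype.card F - 1) * ((Fintype.card F - 1) / 2) := by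
    have h2 : 2 ∣ Fintype.card F - 1 := (by decide : 2 ∣ 4).trans h4
    rw [← Nat.mul_div_assoc _ h2, Nat.div_mul_cancel (Nat.sub_one_dvd_pow_sub_one ..)]
  have hdiscr := FiniteField.discr_pow_card_sub_one_div_two hF pb.basis
  rw [Algebra.discr_powerBasis_eq_norm, mul_pow, ← pow_mul, mul_comm, mul_comm _ (_ / 2), pow_mul,
    heven.neg_one_pow, one_pow, mul_one,
    AdjoinRoot.minpoly_powerBasis_gen_of_monic hmonic, AdjoinRoot.powerBasis_gen,
    AdjoinRoot.aeval_eq, AdjoinRoot.powerBasis_dim] at hdiscr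
  have hodd : Odd (f.natDegree - 1) := Nat.Even.sub_odd hirr.natDegree_pos hd odd_one
  rw [hodd.neg_one_pow] at hdiscr
  have hK := congrArg (algebraMap F (AdjoinRoot f)) hdiscr
  rw [map_pow, FiniteField.algebraMap_norm_eq_pow, hcard, Nat.card_eq_fintype_card, ← pow_mul,
    ← hexp, map_neg, map_one] at hK
  rw [hK]
  have h2 : ringChar F ≠ 2 := by
    intro h
    have := FiniteField.even_card_of_char_two h
    rw [Nat.odd_iff] at hF
    omega
  rw [← map_one (algebraMap F (AdjoinRoot f)), ← map_neg]
  exact (algebraMap F (AdjoinRoot f)).injective.ne (Ring.neg_one_ne_one_of_char_ne_two h2)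
end

section
/- (Theorem conditional on the Weak Generalized Riemann Hypothesis.) Fix ε with 0 ≤ ε < 1/2. Suppose that for every prime p and every nontrivial Dirichlet character χ modulo p, every zero s of the Dirichlet L-function L(s,χ) with 0 < Re(s) < 1 satisfies 1/2 - ε < Re(s) < 1/2 + ε, and that the same strip condition holds for all nontrivial zeros of the Riemann zeta function. Then there is a constant C > 0 such that for every prime p and every prime r dividing p-1, the least r-th nonresidue n(p,r) modulo p satisfies n(p,r) ≤ C·(log p)^{4/(1-2ε)}; i.e. there is a positive integer a ≤ C·(log p)^{4/(1-2ε)} with a^{(p-1)/r} ≢ 1 (mod p). -/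
open Complex Metric in
/-- A Borel-Carathéodory bound for the logarithmic derivative of a nonvanishing holomorphic
function on a disc. -/
lemma norm_deriv_div_le_of_norm_le_exp_mul {f : ℂ → ℂ} {c z : ℂ} {r R M : ℝ}
    (hf : DifferentiableOn ℂ f (ball c R)) (hne : ∀ w ∈ ball c R, f w ≠ 0) (hM : 0 < M)
    (hbd : ∀ w ∈ ball c R, ‖f w‖ ≤ Real.exp M * ‖f c‖) (hrR : r < R)
    (hz : ‖z - c‖ ≤ r) :
    ‖deriv f z / f z‖ ≤ 4 * (R + r) / (R - r) ^ 2 * M := by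
  have hr : 0 ≤ r := (norm_nonneg _).trans hz
  have hR : 0 < R := hr.trans_lt hrR
  have hc : c ∈ ball c R := mem_ball_self hR
  have hdf : DifferentiableOn ℂ (fun w ↦ deriv f w / f w) (ball c R) :=
    (hf.deriv isOpen_ball).div hf hne
  obtain ⟨g, hg0, hg⟩ := hdf.isExactOn_ball.with_val_at c 0
  have hexp : ∀ w ∈ ball c R, f w = f c * exp (g w) := by
    have hd : ∀ w ∈ ball c R, HasDerivAt (fun w ↦ f w * exp (-g w)) 0 w := by
      intro w hw
      have h1 := ((hf w hw).differentiableAt (isOpen_ball.mem_nhds hw)).hasDerivAt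
      convert! h1.mul (hg w hw).neg.cexp using 1
      field_simp [hne w hw]
      ring
    intro w hw
    have := (convex_ball c R).is_const_of_fderivWithin_eq_zero (𝕜 := ℂ)
      (f := fun w ↦ f w * exp (-g w))
      (fun x hx ↦ (hd x hx).differentiableAt.differentiableWithinAt)
      (fun x hx ↦ by
        rw [fderivWithin_of_isOpen isOpen_ball hx]
        ext; simp [(hd x hx).deriv]) hw hc
    simp only [hg0, neg_zero, exp_zero, mul_one] at this
    rw [← this, mul_assoc, ← exp_add]; simp
  have hgd : DifferentiableOn ℂ g (ball c R) := fun w hw ↦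
    (hg w hw).differentiableAt.differentiableWithinAt
  have hre : ∀ w ∈ ball c R, (g w).re ≤ M := by
    intro w hw
    have h := hbd w hw
    rw [hexp w hw, norm_mul, norm_exp, mul_comm] at h
    exact Real.exp_le_exp.mp (le_of_mul_le_mul_right h (norm_pos_iff.mpr (hne c hc)))
  have hbc : ∀ w, ‖w - c‖ ≤ (R + r) / 2 → ‖g w‖ ≤ 2 * M * (R + r) / (R - r) := by
    intro w hw
    have hmaps : Set.MapsTo (fun u : ℂ ↦ u + c) (ball 0 R) (ball c R) := fun u hu ↦ by
      simpa [dist_eq_norm] using hu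
    have hwR : ‖w - c‖ < R := by linarith
    have h := borelCaratheodory (f := fun u ↦ g (u + c)) (z := w - c) hM
      (hgd.comp (by fun_prop) hmaps) (fun u hu ↦ hre _ (hmaps hu)) hR (by simpa using hwR)
    simp only [zero_add, hg0, norm_zero, zero_mul, zero_div, add_zero, sub_add_cancel] at h
    refine h.trans ?_
    calc 2 * M * ‖w - c‖ / (R - ‖w - c‖) ≤ 2 * M * ((R + r) / 2) / ((R - r) / 2) := by
          gcongr
          linarith
      _ = _ := by
          have : R - r ≠ 0 := by linarith
          field_simp
  have hρ : 0 < (R - r) / 2 := by linarith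
  have hsub : closedBall z ((R - r) / 2) ⊆ ball c R := fun w hw ↦ by
    rw [mem_closedBall, dist_eq_norm] at hw
    rw [mem_ball, dist_eq_norm]
    calc ‖w - c‖ ≤ ‖w - z‖ + ‖z - c‖ := by simpa using norm_add_le (w - z) (z - c)
      _ < R := by linarith
  have hder := norm_deriv_le_of_forall_mem_sphere_norm_le (f := g) (c := z)
    (C := 2 * M * (R + r) / (R - r)) hρ
    ⟨hgd.mono (ball_subset_closedBall.trans hsub), by
      rw [closure_ball _ hρ.ne']; exact hgd.continuousOn.mono hsub⟩
    (fun w hw ↦ hbc w (by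
      rw [mem_sphere, dist_eq_norm] at hw
      calc ‖w - c‖ ≤ ‖w - z‖ + ‖z - c‖ := by simpa using norm_add_le (w - z) (z - c)
        _ ≤ _ := by linarith))
  rw [(hg z (hsub (mem_closedBall_self hρ.le))).deriv] at hder
  refine hder.trans_eq ?_
  have : R - r ≠ 0 := by linarith
  field_simp
  ring

/-- A logarithmic derivative bound in a vertical strip for a function of polynomial growth in a
zero-free half-plane. -/
lemma norm_deriv_div_le_of_polynomial_growth {f : ℂ → ℂ} {σ₀ σ₁ M : ℝ} (hσ₀ : 0 ≤ σ₀)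
    (hσ : σ₀ < σ₁) (hM : 1 ≤ M) (hf : Differentiable ℂ f)
    (hne : ∀ s : ℂ, σ₀ < s.re → f s ≠ 0)
    (hbd : ∀ s : ℂ, σ₀ < s.re → ‖f s‖ ≤ M * (1 + ‖s‖) ^ 2)
    (hlow : ∀ s : ℂ, s.re = 2 → 1 / 3 ≤ ‖f s‖) {s : ℂ} (h1 : σ₁ ≤ s.re) (h2 : s.re ≤ 2) :
    ‖deriv f s / f s‖ ≤
      4 * (2 - σ₀ + (2 - σ₁)) / (σ₁ - σ₀) ^ 2 * (Real.log M + 12 + 2 * ‖s‖) := by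
  set c : ℂ := ⟨2, s.im⟩ with hc
  have hsc : ‖s - c‖ ≤ 2 - σ₁ := by
    have : s - c = ((s.re - 2 : ℝ) : ℂ) := by apply Complex.ext <;> simp [hc]
    rw [this, Complex.norm_real, Real.norm_eq_abs, abs_le]
    constructor <;> linarith
  have hball : ∀ w ∈ Metric.ball c (2 - σ₀), σ₀ < w.re := by
    intro w hw
    rw [Metric.mem_ball, dist_eq_norm] at hw
    have h := (abs_le.mp (Complex.abs_re_le_norm (w - c))).1
    have : (w - c).re = w.re - 2 := by simp [hc]
    linarith
  have hlogM := Real.log_nonneg hM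
  have key := norm_deriv_div_le_of_norm_le_exp_mul (f := f) (c := c) (z := s) (r := 2 - σ₁)
    (R := 2 - σ₀) (M := Real.log M + 12 + 2 * ‖s‖) hf.differentiableOn
    (fun w hw ↦ hne w (hball w hw)) (by positivity) ?_ (by linarith) hsc
  · convert key using 3
    ring
  intro w hw
  have hw' : ‖w‖ ≤ ‖s‖ + 4 := by
    rw [Metric.mem_ball, dist_eq_norm] at hw
    have e1 : ‖w‖ ≤ ‖w - c‖ + ‖c‖ := by simpa using norm_add_le (w - c) c
    have e2 : ‖c‖ ≤ ‖s - c‖ + ‖s‖ := by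
      rw [norm_sub_rev s c]; simpa using norm_add_le (c - s) s
    linarith
  have e5 : 5 + ‖s‖ ≤ Real.exp (4 + ‖s‖) := by linarith [Real.add_one_le_exp (4 + ‖s‖)]
  have e3 : (3 : ℝ) ≤ Real.exp 2 := by linarith [Real.add_one_le_exp (2 : ℝ)]
  calc ‖f w‖ ≤ M * (1 + ‖w‖) ^ 2 := hbd w (hball w hw)
    _ ≤ M * (5 + ‖s‖) ^ 2 := by
        have : 1 + ‖w‖ ≤ 5 + ‖s‖ := by linarith
        gcongr
    _ ≤ M * (Real.exp (4 + ‖s‖)) ^ 2 := by gcongr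
    _ = 3 * (M * (Real.exp (4 + ‖s‖)) ^ 2) * (1 / 3) := by ring
    _ ≤ Real.exp 2 * (M * (Real.exp (4 + ‖s‖)) ^ 2) * ‖f c‖ := by
        gcongr
        exact hlow c rfl
    _ ≤ Real.exp (Real.log M + 12 + 2 * ‖s‖) * ‖f c‖ := by
        gcongr
        rw [show Real.log M + 12 + 2 * ‖s‖ = 2 + (Real.log M + (2 : ℕ) * (4 + ‖s‖)) + 2 by
          push_cast; ring, Real.exp_add _ 2, Real.exp_add 2, Real.exp_add (Real.log M),
          Real.exp_log (by linarith), Real.exp_nat_mul]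
        exact le_mul_of_one_le_right (by positivity) (Real.one_le_exp (by norm_num))

open Complex Filter Set MeasureTheory Asymptotics Topology in
/-- Analytic continuation by partial summation: if the summatory function of `f` is
`c * n + O(1)`, the Dirichlet series of `f` is `c * s / (s - 1)` plus `s` times a bounded function
holomorphic on the right half-plane. -/
lemma LSeries_continuation_of_sum_sub_le {f : ℕ → ℂ} {c : ℂ} {B : ℝ}
    (hB : ∀ n : ℕ, ‖∑ k ∈ Finset.Icc 1 n, f k - c * n‖ ≤ B)
    (hsum : ∀ s : ℂ, 1 < s.re → LSeriesSummable f s) :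
    ∃ J : ℂ → ℂ, DifferentiableOn ℂ J {s | 0 < s.re} ∧
      (∀ s : ℂ, 0 < s.re → ‖J s‖ ≤ (B + ‖c‖) / s.re) ∧
      ∀ s : ℂ, 1 < s.re → LSeries f s = c * (s / (s - 1)) + s * J s := by
  set E : ℝ → ℂ := fun t ↦ ∑ k ∈ Finset.Icc 1 ⌊t⌋₊, f k - c * t with hE
  have hSm : Measurable fun t : ℝ ↦ ∑ k ∈ Finset.Icc 1 ⌊t⌋₊, f k :=
    (measurable_of_countable (fun n : ℕ ↦ ∑ k ∈ Finset.Icc 1 n, f k)).comp Nat.measurable_floor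
  have hEm : Measurable E := hSm.sub (by fun_prop)
  have hEb : ∀ t : ℝ, 0 ≤ t → ‖E t‖ ≤ B + ‖c‖ := by
    intro t ht
    have e : E t = (∑ k ∈ Finset.Icc 1 ⌊t⌋₊, f k - c * (⌊t⌋₊ : ℕ)) + c * ((⌊t⌋₊ - t : ℝ) : ℂ) := by
      simp only [hE]; push_cast; ring
    rw [e]
    refine (norm_add_le _ _).trans (add_le_add (hB _) ?_)
    rw [norm_mul, norm_real, Real.norm_eq_abs]
    refine mul_le_of_le_one_right (norm_nonneg _) ?_
    rw [abs_le]
    constructor <;> linarith [Nat.floor_le ht, Nat.lt_floor_add_one t]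
  have hK : 0 ≤ B + ‖c‖ := (norm_nonneg _).trans (hEb 0 le_rfl)
  set J : ℂ → ℂ := fun s ↦ ∫ t in Ioi (1 : ℝ), E t * (t : ℂ) ^ (-(s + 1)) with hJ
  have hbdint : ∀ s : ℂ, 0 < s.re → ∀ t ∈ Ioi (1 : ℝ),
      ‖E t * (t : ℂ) ^ (-(s + 1))‖ ≤ (B + ‖c‖) * t ^ (-s.re - 1) := by
    intro s hs t ht
    have ht0 : (0 : ℝ) < t := zero_lt_one.trans ht
    rw [norm_mul, norm_cpow_eq_rpow_re_of_pos ht0]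
    have : (-(s + 1)).re = -s.re - 1 := by simp; ring
    rw [this]
    gcongr
    exact hEb t ht0.le
  have hrint : ∀ s : ℂ, 0 < s.re →
      IntegrableOn (fun t : ℝ ↦ (B + ‖c‖) * t ^ (-s.re - 1)) (Ioi 1) := fun s hs ↦
    (integrableOn_Ioi_rpow_of_lt (by linarith) zero_lt_one).const_mul _
  have hcpm : ∀ s : ℂ, Measurable fun t : ℝ ↦ (t : ℂ) ^ (-(s + 1)) := fun s ↦ by fun_prop
  have hEint : ∀ s : ℂ, 0 < s.re →
      IntegrableOn (fun t : ℝ ↦ E t * (t : ℂ) ^ (-(s + 1))) (Ioi 1) := fun s hs ↦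
    (hrint s hs).mono' (hEm.mul (hcpm s)).aestronglyMeasurable
      ((ae_restrict_iff' measurableSet_Ioi).mpr (ae_of_all _ (hbdint s hs)))
  refine ⟨J, ?_, ?_, ?_⟩
  · set F : ℝ → ℂ := (Ioi (1 : ℝ)).indicator E with hF
    have hFm : Measurable F := hEm.indicator measurableSet_Ioi
    have hFb : ∀ t, ‖F t‖ ≤ B + ‖c‖ := by
      intro t
      by_cases ht : t ∈ Ioi (1 : ℝ)
      · rw [hF, indicator_of_mem ht]; exact hEb t (zero_le_one.trans (le_of_lt ht))
      · rw [hF, indicator_of_notMem ht]; simpa using hK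
    have hJF : ∀ s, J s = mellin F (-s) := by
      intro s
      rw [mellin, hJ]
      simp only [smul_eq_mul]
      have : ∀ t : ℝ, (t : ℂ) ^ (-s - 1) * F t =
          (Ioi (1 : ℝ)).indicator (fun t : ℝ ↦ E t * (t : ℂ) ^ (-(s + 1))) t := by
        intro t
        rw [hF]
        by_cases ht : t ∈ Ioi (1 : ℝ)
        · rw [indicator_of_mem ht, indicator_of_mem ht, mul_comm]; congr 2; ring
        · rw [indicator_of_notMem ht, indicator_of_notMem ht, mul_zero]
      simp_rw [this]
      rw [setIntegral_indicator measurableSet_Ioi,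
        inter_eq_self_of_subset_right (Ioi_subset_Ioi zero_le_one)]
    intro s hs
    have hs' : 0 < s.re := hs
    have hm : DifferentiableAt ℂ (mellin F) (-s) := by
      refine mellin_differentiableAt_of_isBigO_rpow (a := 0) (b := -s.re - 1) ?_ ?_ ?_ ?_ ?_
      · refine LocallyIntegrable.locallyIntegrableOn ?_ _
        refine (locallyIntegrable_const (B + ‖c‖)).mono hFm.aestronglyMeasurable
          (ae_of_all _ fun t ↦ ?_)
        rw [Real.norm_of_nonneg hK]; exact hFb t
      · simp only [neg_zero, Real.rpow_zero]
        exact isBigO_of_le' (c := B + ‖c‖) _ fun t ↦ by simpa using hFb t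
      · simpa using hs'
      · refine EventuallyEq.trans_isBigO (f₂ := fun _ ↦ 0) ?_ (isBigO_zero _ _)
        filter_upwards [Ioo_mem_nhdsGT (zero_lt_one (α := ℝ))] with t ht
        exact indicator_of_notMem (by simpa using ht.2.le) _
      · simp
    have : DifferentiableAt ℂ (fun s ↦ mellin F (-s)) s :=
      DifferentiableAt.fun_comp' (g := mellin F) (f := fun s ↦ -s) s hm
        (by fun_prop)
    exact (this.congr_of_eventuallyEq (Eventually.of_forall hJF)).differentiableWithinAt
  · intro s hs
    refine (norm_integral_le_of_norm_le (hrint s hs)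
      ((ae_restrict_iff' measurableSet_Ioi).mpr (ae_of_all _ (hbdint s hs)))).trans_eq ?_
    rw [integral_const_mul, integral_Ioi_rpow_of_lt (by linarith) zero_lt_one]
    simp [div_eq_mul_inv]
  · intro s hs
    have hO : (fun n ↦ ∑ k ∈ Finset.Icc 1 n, f k) =O[atTop] fun n ↦ (n : ℝ) ^ (1 : ℝ) := by
      refine IsBigO.of_bound (B + ‖c‖) ?_
      filter_upwards [eventually_ge_atTop 1] with n hn
      have hn' : (1 : ℝ) ≤ n := by exact_mod_cast hn
      have hB0 : 0 ≤ B := (norm_nonneg _).trans (hB 0)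
      rw [Real.rpow_one, Real.norm_of_nonneg (by positivity)]
      calc ‖∑ k ∈ Finset.Icc 1 n, f k‖ ≤ ‖∑ k ∈ Finset.Icc 1 n, f k - c * n‖ + ‖c * n‖ := by
            simpa using norm_add_le (∑ k ∈ Finset.Icc 1 n, f k - c * n) (c * n)
        _ ≤ B + ‖c‖ * n := by
            refine add_le_add (hB n) ?_
            simp
        _ ≤ (B + ‖c‖) * n := by nlinarith
    rw [LSeries_eq_mul_integral f zero_le_one hs (hsum s hs) hO]
    have hs0 : 0 < s.re := zero_lt_one.trans hs
    have hcint : IntegrableOn (fun t : ℝ ↦ c * (t : ℂ) ^ (-s)) (Ioi 1) :=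
      (integrableOn_Ioi_cpow_of_lt (by simpa using hs) zero_lt_one).const_mul c
    have e : ∫ t in Ioi (1 : ℝ), (∑ k ∈ Finset.Icc 1 ⌊t⌋₊, f k) * (t : ℂ) ^ (-(s + 1)) =
        ∫ t in Ioi (1 : ℝ), (c * (t : ℂ) ^ (-s) + E t * (t : ℂ) ^ (-(s + 1))) := by
      refine setIntegral_congr_fun measurableSet_Ioi fun t ht ↦ ?_
      have ht0 : (t : ℂ) ≠ 0 := by
        exact_mod_cast (zero_lt_one.trans ht).ne'
      have : (t : ℂ) ^ (-s) = t * (t : ℂ) ^ (-(s + 1)) := by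
        rw [show -s = 1 + -(s + 1) by ring, cpow_add _ _ ht0, cpow_one]
      simp only [hE]
      rw [this]; ring
    rw [e, integral_add hcint (hEint s hs0), integral_const_mul,
      integral_Ioi_cpow_of_lt (by simpa using hs) zero_lt_one]
    have : s - 1 ≠ 0 := fun h ↦ by
      rw [sub_eq_zero.mp h] at hs; simp at hs
    have h' : -s + 1 ≠ 0 := fun h ↦ this (by linear_combination -h)
    simp only [hJ, ofReal_one, one_cpow]
    field_simp
    ring

/-- Two holomorphic functions on the right half-plane which agree for `1 < re s` are equal. -/
lemma eqOn_re_pos_of_eqOn_one_lt_re {F G : ℂ → ℂ} (hF : DifferentiableOn ℂ F {s | 0 < s.re})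
    (hG : DifferentiableOn ℂ G {s | 0 < s.re}) (h : ∀ s : ℂ, 1 < s.re → F s = G s) {s : ℂ}
    (hs : 0 < s.re) : F s = G s := by
  have hopen : IsOpen {s : ℂ | 0 < s.re} := isOpen_lt continuous_const Complex.continuous_re
  refine (hF.analyticOnNhd hopen).eqOn_of_preconnected_of_eventuallyEq (hG.analyticOnNhd hopen)
    (convex_halfSpace_re_gt 0).isPreconnected (z₀ := 2) (by simp) ?_ hs
  filter_upwards [(isOpen_lt continuous_const Complex.continuous_re).mem_nhds
    (show (1 : ℝ) < (2 : ℂ).re by simp)] with w hw using h w hw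

/-- The sums of a nontrivial Dirichlet character modulo `N` over initial segments are bounded
by `N`. -/
lemma DirichletCharacter.norm_sum_Icc_le {N : ℕ} [NeZero N] {χ : DirichletCharacter ℂ N}
    (hχ : χ ≠ 1) (n : ℕ) : ‖∑ k ∈ Finset.Icc 1 n, χ (k : ZMod N)‖ ≤ N := by
  have hN : 0 < N := Nat.pos_of_ne_zero (NeZero.ne N)
  have hper : ∑ k ∈ Finset.range N, χ ((k : ZMod N)) = 0 := by
    rw [← MulChar.sum_eq_zero_of_ne_one hχ]
    refine Finset.sum_bij' (fun k _ ↦ (k : ZMod N)) (fun a _ ↦ a.val) (by simp)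
      (fun a _ ↦ by simpa using ZMod.val_lt a) (fun k hk ↦ ?_) (fun a _ ↦ by simp) (by simp)
    exact ZMod.val_cast_of_lt (Finset.mem_range.mp hk)
  have hrange : ∀ m : ℕ, ‖∑ k ∈ Finset.range m, χ ((k + 1 : ℕ) : ZMod N)‖ ≤ N := by
    intro m
    induction m using Nat.strong_induction_on with
    | _ m ih =>
      rcases lt_or_ge m N with h | h
      · refine (norm_sum_le _ _).trans ((Finset.sum_le_card_nsmul _ _ 1
          fun k _ ↦ DirichletCharacter.norm_le_one χ _).trans ?_)
        simpa using h.le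
      · obtain ⟨d, rfl⟩ := Nat.exists_eq_add_of_le h
        have hshift : ∑ k ∈ Finset.range N, χ ((k + 1 : ℕ) : ZMod N) = 0 := by
          have := Finset.sum_range_succ' (fun k : ℕ ↦ χ (k : ZMod N)) N
          rw [Finset.sum_range_succ, hper] at this
          simpa using this
        rw [Finset.sum_range_add, hshift, zero_add]
        refine le_trans (le_of_eq ?_) (ih d (by lia))
        congr 1
        refine Finset.sum_congr rfl fun k _ ↦ ?_
        congr 1
        push_cast
        simp
  have h := hrange n
  rw [Finset.range_eq_Ico, Finset.sum_Ico_add' (fun k : ℕ ↦ χ (k : ZMod N))] at h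
  rwa [show Finset.Icc 1 n = Finset.Ico (0 + 1) (n + 1) by ext; simp]

/-- A linear bound for the `L`-function of a nontrivial Dirichlet character to the right of the
line `re s = 1 / 2`. -/
lemma DirichletCharacter.norm_LFunction_le {N : ℕ} [NeZero N] {χ : DirichletCharacter ℂ N}
    (hχ : χ ≠ 1) {s : ℂ} (hs : 1 / 2 < s.re) : ‖LFunction χ s‖ ≤ 2 * N * ‖s‖ := by
  obtain ⟨J, hJd, hJb, hJ⟩ := LSeries_continuation_of_sum_sub_le
    (f := fun n ↦ χ (n : ZMod N)) (c := 0) (B := N)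
    (fun n ↦ by simpa using norm_sum_Icc_le hχ n)
    (fun s hs ↦ LSeriesSummable_of_one_lt_re χ hs)
  have hs0 : 0 < s.re := by linarith
  have h : LFunction χ s = s * J s := by
    refine eqOn_re_pos_of_eqOn_one_lt_re (F := LFunction χ) (G := fun s ↦ s * J s)
      (differentiable_LFunction hχ).differentiableOn (differentiableOn_id.mul hJd)
      (fun w hw ↦ ?_) hs0
    rw [LFunction_eq_LSeries χ hw, hJ w hw]; simp
  rw [h, norm_mul, mul_comm]
  gcongr
  refine (hJb s hs0).trans ?_
  rw [norm_zero, add_zero, div_le_iff₀ hs0]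
  have : (0 : ℝ) ≤ N := by positivity
  nlinarith

/-- A quadratic bound for `(s - 1) * ζ(s)` to the right of the line `re s = 1 / 2`. -/
lemma norm_LFunctionTrivChar₁_one_le {s : ℂ} (hs : 1 / 2 < s.re) :
    ‖DirichletCharacter.LFunctionTrivChar₁ 1 s‖ ≤ 3 * (1 + ‖s‖) ^ 2 := by
  obtain ⟨J, hJd, hJb, hJ⟩ := LSeries_continuation_of_sum_sub_le
    (f := 1) (c := 1) (B := 0) (fun n ↦ by simp)
    (fun s hs ↦ LSeriesSummable_one_iff.mpr hs)
  have hs0 : 0 < s.re := by linarith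
  have h : DirichletCharacter.LFunctionTrivChar₁ 1 s = s + (s - 1) * (s * J s) := by
    refine eqOn_re_pos_of_eqOn_one_lt_re (G := fun s ↦ s + (s - 1) * (s * J s))
      (DirichletCharacter.differentiable_LFunctionTrivChar₁ 1).differentiableOn
      (differentiableOn_id.add ((differentiableOn_id.sub_const 1).mul (differentiableOn_id.mul hJd)))
      (fun w hw ↦ ?_) hs0
    have hw1 : w ≠ 1 := fun h ↦ by simp [h] at hw
    have hw1' : w - 1 ≠ 0 := sub_ne_zero.mpr hw1
    rw [DirichletCharacter.LFunctionTrivChar₁, Function.update_of_ne hw1,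
      DirichletCharacter.LFunctionTrivChar, DirichletCharacter.LFunction_modOne_eq,
      ← LSeries_one_eq_riemannZeta hw, hJ w hw]
    field_simp
  have hJ2 : ‖J s‖ ≤ 2 := (hJb s hs0).trans (by
    rw [norm_one, div_le_iff₀ hs0]; linarith)
  have h1 : ‖s - 1‖ ≤ 1 + ‖s‖ := by simpa [add_comm] using norm_sub_le s 1
  rw [h]
  calc ‖s + (s - 1) * (s * J s)‖ ≤ ‖s‖ + ‖s - 1‖ * (‖s‖ * ‖J s‖) := by
        simpa only [norm_mul] using norm_add_le s ((s - 1) * (s * J s))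
    _ ≤ ‖s‖ + (1 + ‖s‖) * (‖s‖ * 2) := by gcongr
    _ ≤ 3 * (1 + ‖s‖) ^ 2 := by nlinarith [norm_nonneg s]

/-- A Dirichlet series with leading coefficient `1` and all coefficients bounded by `1` is
bounded away from zero on the line `re s = 2`. -/
lemma one_third_le_norm_LSeries {f : ℕ → ℂ} (h1 : f 1 = 1) (hf : ∀ n, ‖f n‖ ≤ 1) {s : ℂ}
    (hs : s.re = 2) : 1 / 3 ≤ ‖LSeries f s‖ := by
  have hsum : LSeriesSummable f s :=
    LSeriesSummable_of_bounded_of_one_lt_re (m := 1) (fun n _ ↦ hf n) (by rw [hs]; norm_num)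
  have hterm : ∀ n, ‖LSeries.term f s n‖ ≤ 1 / (n : ℝ) ^ 2 := by
    intro n
    rw [LSeries.norm_term_eq]
    split_ifs with h
    · positivity
    · rw [hs, Real.rpow_ofNat]
      gcongr
      exact hf n
  have e1 := (hasSum_ite_eq 1 (1 : ℂ)).summable
  have z2 := hasSum_zeta_two
  have hsub : LSeries f s - 1 = ∑' n, (LSeries.term f s n - if n = 1 then 1 else 0) := by
    rw [Summable.tsum_sub hsum e1, tsum_ite_eq]; rfl
  have hb : ‖LSeries f s - 1‖ ≤ Real.pi ^ 2 / 6 - 1 := by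
    rw [hsub]
    refine tsum_of_norm_bounded (z2.sub (hasSum_ite_eq 1 (1 : ℝ))) fun n ↦ ?_
    by_cases hn : n = 1
    · subst hn; simp [h1]
    · simpa [hn] using hterm n
  have h3 : ‖(1 : ℂ)‖ ≤ ‖LSeries f s‖ + ‖LSeries f s - 1‖ := by
    have := norm_sub_le (LSeries f s) (LSeries f s - 1)
    simpa using this
  rw [norm_one] at h3
  nlinarith [Real.pi_lt_d2, Real.pi_pos]

/-- Some nontrivial Dirichlet character modulo `p` takes the value `1` at every `r`-th power
residue. -/
lemma exists_dirichletCharacter_ne_one_of_dvd {p r : ℕ} [Fact p.Prime] (hr : r.Prime)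
    (hrp : r ∣ p - 1) : ∃ χ : DirichletCharacter ℂ p, χ ≠ 1 ∧
      ∀ a : ZMod p, a ^ ((p - 1) / r) = 1 → χ a = 1 := by
  have hp : 0 < p - 1 := Nat.sub_pos_of_lt (Fact.out : p.Prime).one_lt
  obtain ⟨χ, hχ⟩ := MulChar.exists_mulChar_orderOf (ZMod p) (R := ℂ) (n := p - 1)
    (by rw [ZMod.card]) (Complex.isPrimitiveRoot_exp _ hp.ne')
  have hd : 0 < (p - 1) / r := Nat.div_pos (Nat.le_of_dvd hp hrp) hr.pos
  refine ⟨χ ^ ((p - 1) / r), fun h ↦ ?_, fun a ha ↦ ?_⟩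
  · have h1 := Nat.le_of_dvd hd (hχ ▸ orderOf_dvd_of_pow_eq_one h)
    exact absurd (Nat.div_lt_self hp hr.one_lt) (not_lt.mpr h1)
  · rw [MulChar.pow_apply' _ hd.ne', ← map_pow, ha, map_one]

open ArithmeticFunction in
/-- If `χ n = 1` for all `0 < n ≤ X`, the Dirichlet series with coefficients `Λ(n) (χ(n) - 1)`
is `O(X ^ (-2 / 3))` on the line `re s = 2`. -/
lemma norm_LSeries_twist_vonMangoldt_sub_le {N : ℕ} {χ : DirichletCharacter ℂ N} {X : ℝ}
    (hX : 0 < X) (h : ∀ n : ℕ, 0 < n → (n : ℝ) ≤ X → χ (n : ZMod N) = 1) {s : ℂ}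
    (hs : s.re = 2) :
    ‖LSeries ((fun n : ℕ ↦ χ (n : ZMod N)) * fun n ↦ (vonMangoldt n : ℂ)) s -
        LSeries (fun n ↦ (vonMangoldt n : ℂ)) s‖ ≤
      2 * (∑' n, ‖LSeries.term (fun n ↦ (vonMangoldt n : ℂ)) (4 / 3 : ℝ) n‖) *
        X ^ (-(2 / 3) : ℝ) := by
  have hs1 : 1 < s.re := by rw [hs]; norm_num
  have hs2 : LSeriesSummable (fun n ↦ (vonMangoldt n : ℂ)) (4 / 3 : ℝ) :=
    LSeriesSummable_vonMangoldt (by norm_num [Complex.ofReal_re])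
  have hsum := hs2.norm
  rw [← LSeries_sub (DirichletCharacter.LSeriesSummable_twist_vonMangoldt χ hs1)
    (LSeriesSummable_vonMangoldt hs1), mul_right_comm]
  refine tsum_of_norm_bounded (hsum.hasSum.mul_left (2 * X ^ (-(2 / 3) : ℝ))) fun n ↦ ?_
  simp only [LSeries.norm_term_eq, Pi.sub_apply, Pi.mul_apply]
  split_ifs with hn
  · simp
  have hn0 : 0 < n := Nat.pos_of_ne_zero hn
  have hn' : (0 : ℝ) < n := by exact_mod_cast hn0
  rcases le_or_gt (n : ℝ) X with hle | hlt
  · rw [h n hn0 hle]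
    simp only [one_mul, sub_self, norm_zero, zero_div]
    positivity
  · have h1 : ‖χ (n : ZMod N) * (vonMangoldt n : ℂ) - (vonMangoldt n : ℂ)‖ ≤
        2 * ‖(vonMangoldt n : ℂ)‖ := by
      rw [← sub_one_mul, norm_mul]
      gcongr
      refine (norm_sub_le _ _).trans ?_
      rw [norm_one]
      linarith [χ.norm_le_one (n : ZMod N)]
    have h2 : ((n : ℝ) ^ s.re)⁻¹ ≤ X ^ (-(2 / 3) : ℝ) * ((n : ℝ) ^ (4 / 3 : ℝ))⁻¹ := by
      rw [hs, ← Real.rpow_neg hn'.le, ← Real.rpow_neg hn'.le,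
        show (-2 : ℝ) = -(2 / 3) + -(4 / 3) by norm_num, Real.rpow_add hn']
      gcongr ?_ * _
      exact Real.rpow_le_rpow_of_nonpos hX hlt.le (by norm_num)
    rw [Complex.ofReal_re, div_eq_mul_inv, div_eq_mul_inv]
    calc _ ≤ (2 * ‖(vonMangoldt n : ℂ)‖) * (X ^ (-(2 / 3) : ℝ) * ((n : ℝ) ^ (4 / 3 : ℝ))⁻¹) :=
          mul_le_mul h1 h2 (by positivity) (by positivity)
      _ = _ := by ring

open DirichletCharacter in
/-- The function `(s - 1) * ζ(s)` is bounded away from zero on the line `re s = 2`. -/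
lemma one_third_le_norm_LFunctionTrivChar₁_one {s : ℂ} (hs : s.re = 2) :
    1 / 3 ≤ ‖LFunctionTrivChar₁ 1 s‖ := by
  have hs1 : 1 < s.re := by rw [hs]; norm_num
  have hne : s ≠ 1 := fun h ↦ by simp [h] at hs1
  have h1 : 1 ≤ ‖s - 1‖ := by
    have := Complex.re_le_norm (s - 1)
    rw [Complex.sub_re, hs, Complex.one_re] at this
    linarith
  rw [LFunctionTrivChar₁, Function.update_of_ne hne, LFunctionTrivChar, LFunction_modOne_eq,
    ← LSeries_one_eq_riemannZeta hs1, norm_mul]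
  have := one_third_le_norm_LSeries (f := 1) rfl (by simp) hs
  nlinarith

/-- The function `(s - 1) * (ζ'(s) / ζ(s) - L'(s, χ) / L(s, χ))`, with its removable singularity
at `s = 1` filled in, divided by `s ^ 2`. -/
noncomputable def logDerivDifference {N : ℕ} [NeZero N] (χ : DirichletCharacter ℂ N) (s : ℂ) : ℂ :=
  ((s - 1) * (deriv (DirichletCharacter.LFunctionTrivChar₁ 1) s /
    DirichletCharacter.LFunctionTrivChar₁ 1 s -
      deriv χ.LFunction s / χ.LFunction s) - 1) / s ^ 2

section logDerivDifference

open DirichletCharacter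

variable {N : ℕ} [NeZero N] {χ : DirichletCharacter ℂ N} {σ₀ : ℝ}

lemma differentiableOn_logDerivDifference (hσ₀ : 1 / 2 ≤ σ₀) (hχ : χ ≠ 1)
    (hζ : ∀ s : ℂ, σ₀ < s.re → LFunctionTrivChar₁ 1 s ≠ 0)
    (hL : ∀ s : ℂ, σ₀ < s.re → χ.LFunction s ≠ 0) :
    DifferentiableOn ℂ (logDerivDifference χ) {s | σ₀ < s.re} := by
  have hopen : IsOpen {s : ℂ | σ₀ < s.re} := isOpen_lt continuous_const Complex.continuous_re
  have h1 := (differentiable_LFunctionTrivChar₁ 1).differentiableOn (s := {s : ℂ | σ₀ < s.re})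
  have h2 := (differentiable_LFunction hχ).differentiableOn (s := {s : ℂ | σ₀ < s.re})
  refine (((differentiableOn_id.sub_const 1).mul (((h1.deriv hopen).div h1 hζ).sub
    ((h2.deriv hopen).div h2 hL))).sub_const 1).div (differentiableOn_id.pow 2) fun s hs ↦ ?_
  have hs' : σ₀ < s.re := hs
  refine pow_ne_zero 2 fun h ↦ ?_
  rw [show s = 0 from h, Complex.zero_re] at hs'
  linarith

lemma norm_logDerivDifference_le {σ₁ : ℝ} (hσ₀ : 1 / 2 ≤ σ₀) (hσ : σ₀ < σ₁) (hσ₁ : σ₁ < 2)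
    (hN : 3 ≤ N) (hχ : χ ≠ 1)
    (hζ : ∀ s : ℂ, σ₀ < s.re → LFunctionTrivChar₁ 1 s ≠ 0)
    (hL : ∀ s : ℂ, σ₀ < s.re → χ.LFunction s ≠ 0) {s : ℂ} (h1 : σ₁ ≤ s.re) (h2 : s.re ≤ 2) :
    ‖logDerivDifference χ s‖ ≤
      (180 * (4 * (2 - σ₀ + (2 - σ₁)) / (σ₁ - σ₀) ^ 2) + 4) * Real.log N := by
  set K := 4 * (2 - σ₀ + (2 - σ₁)) / (σ₁ - σ₀) ^ 2 with hK
  have hK0 : 0 ≤ K := by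
    have : 0 ≤ 2 - σ₀ + (2 - σ₁) := by linarith
    positivity
  have hN3 : (3 : ℝ) ≤ N := by exact_mod_cast hN
  have hlog : 1 ≤ Real.log N := by
    rw [Real.le_log_iff_exp_le (by linarith)]
    linarith [Real.exp_one_lt_d9]
  have hs : 1 / 2 ≤ ‖s‖ := by linarith [Complex.re_le_norm s]
  have hs1 : ‖s - 1‖ ≤ 1 + ‖s‖ := by simpa [add_comm] using norm_sub_le s 1
  have b1 := norm_deriv_div_le_of_polynomial_growth (by linarith) hσ (by norm_num : (1 : ℝ) ≤ 3)
    (differentiable_LFunctionTrivChar₁ 1) hζ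
    (fun w hw ↦ norm_LFunctionTrivChar₁_one_le (by linarith))
    (fun w hw ↦ one_third_le_norm_LFunctionTrivChar₁_one hw) h1 h2
  have b2 := norm_deriv_div_le_of_polynomial_growth (M := 2 * N) (by linarith) hσ (by linarith)
    (differentiable_LFunction hχ) hL
    (fun w hw ↦ (norm_LFunction_le hχ (by linarith)).trans (by
      gcongr
      nlinarith [norm_nonneg w]))
    (fun w hw ↦ by
      rw [LFunction_eq_LSeries χ (by rw [hw]; norm_num)]
      exact one_third_le_norm_LSeries (by simp) (fun n ↦ χ.norm_le_one _) hw) h1 h2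
  rw [← hK] at b1 b2
  have l3 : Real.log 3 ≤ 2 := by linarith [Real.log_le_sub_one_of_pos (by norm_num : (0 : ℝ) < 3)]
  have l2 : Real.log (2 * N) ≤ 1 + Real.log N := by
    rw [Real.log_mul (by norm_num) (by linarith)]
    linarith [Real.log_le_sub_one_of_pos (by norm_num : (0 : ℝ) < 2)]
  have b3 : ‖deriv (LFunctionTrivChar₁ 1) s / LFunctionTrivChar₁ 1 s -
      deriv χ.LFunction s / χ.LFunction s‖ ≤ K * (60 * (Real.log N * ‖s‖)) := by
    refine (norm_sub_le _ _).trans ((add_le_add b1 b2).trans ?_)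
    rw [← mul_add]
    gcongr
    nlinarith
  rw [logDerivDifference, norm_div, norm_pow, div_le_iff₀ (by positivity)]
  calc _ ≤ ‖s - 1‖ * ‖deriv (LFunctionTrivChar₁ 1) s / LFunctionTrivChar₁ 1 s -
      deriv χ.LFunction s / χ.LFunction s‖ + 1 := by
        refine (norm_sub_le _ _).trans_eq ?_
        rw [norm_mul, norm_one]
    _ ≤ (3 * ‖s‖) * (K * (60 * (Real.log N * ‖s‖))) + 1 := by
        gcongr
        linarith
    _ = 180 * K * Real.log N * ‖s‖ ^ 2 + 1 := by ring
    _ ≤ 180 * K * Real.log N * ‖s‖ ^ 2 + 4 * Real.log N * ‖s‖ ^ 2 := by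
        gcongr
        nlinarith
    _ = _ := by ring

open ArithmeticFunction in
lemma norm_logDerivDifference_le_of_re_eq_two {X : ℝ} (hX : 0 < X)
    (h : ∀ n : ℕ, 0 < n → (n : ℝ) ≤ X → χ (n : ZMod N) = 1) {s : ℂ} (hs : s.re = 2) :
    ‖logDerivDifference χ s‖ ≤
      2 * (∑' n, ‖LSeries.term (fun n ↦ (vonMangoldt n : ℂ)) (4 / 3 : ℝ) n‖) *
        X ^ (-(2 / 3) : ℝ) := by
  have hs1 : 1 < s.re := by rw [hs]; norm_num
  have hne : s ≠ 1 := fun h ↦ by simp [h] at hs1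
  have hne' : s - 1 ≠ 0 := sub_ne_zero.mpr hne
  have hn : 2 ≤ ‖s‖ := hs ▸ Complex.re_le_norm s
  have hs1' : ‖s - 1‖ ≤ 1 + ‖s‖ := by simpa [add_comm] using norm_sub_le s 1
  have hopen : {z : ℂ | 1 < z.re} ∈ nhds s :=
    (isOpen_lt continuous_const Complex.continuous_re).mem_nhds hs1
  have e1 := LSeries_vonMangoldt_eq_deriv_riemannZeta_div hs1
  have e2 := LSeries_twist_vonMangoldt_eq χ hs1
  have e3 : deriv (LSeries fun n : ℕ ↦ χ (n : ZMod N)) s = deriv χ.LFunction s :=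
    Filter.EventuallyEq.deriv_eq (by
      filter_upwards [hopen] with w hw using (LFunction_eq_LSeries χ hw).symm)
  rw [e3, ← LFunction_eq_LSeries χ hs1] at e2
  have e4 : logDerivDifference χ s = (s - 1) / s ^ 2 *
      (LSeries ((fun n : ℕ ↦ χ (n : ZMod N)) * fun n ↦ (vonMangoldt n : ℂ)) s -
        LSeries (fun n ↦ (vonMangoldt n : ℂ)) s) := by
    have hz := riemannZeta_ne_zero_of_one_le_re hs1.le
    rw [logDerivDifference, e1, e2, deriv_LFunctionTrivChar₁_apply_of_ne_one 1 hne,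
      LFunctionTrivChar₁, Function.update_of_ne hne,
      show LFunctionTrivChar 1 = riemannZeta from LFunction_modOne_eq]
    have : ((s - 1) * deriv riemannZeta s + riemannZeta s) / ((s - 1) * riemannZeta s) =
        deriv riemannZeta s / riemannZeta s + 1 / (s - 1) := by field_simp
    rw [this]
    field_simp
    ring
  rw [e4, norm_mul, norm_div, norm_pow]
  refine (mul_le_of_le_one_left (norm_nonneg _) ?_).trans
    (norm_LSeries_twist_vonMangoldt_sub_le hX h hs)
  rw [div_le_one (by positivity)]
  nlinarith

end logDerivDifference

/-- In a zero-free half-plane `re s > σ₀`, a nontrivial character modulo `N` cannot be equal to `1`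
at all positive integers up to a constant times `(log N) ^ (2 / (1 - σ₀))`. -/
lemma exists_forall_le_log_rpow {σ₀ : ℝ} (hσ₀ : 1 / 2 ≤ σ₀) (hσ₀' : σ₀ < 1)
    (hζ : ∀ s : ℂ, σ₀ < s.re → DirichletCharacter.LFunctionTrivChar₁ 1 s ≠ 0) :
    ∃ A : ℝ, 0 < A ∧ ∀ (N : ℕ) [NeZero N] (χ : DirichletCharacter ℂ N) (X : ℝ), 3 ≤ N → χ ≠ 1 →
      (∀ s : ℂ, σ₀ < s.re → χ.LFunction s ≠ 0) → 0 < X →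
      (∀ n : ℕ, 0 < n → (n : ℝ) ≤ X → χ (n : ZMod N) = 1) →
      X ≤ A * Real.log N ^ (2 / (1 - σ₀)) := by
  set σ₁ := 1 - 3 / 4 * (1 - σ₀) with hσ₁
  have h01 : σ₀ < σ₁ := by linarith
  have h11 : σ₁ < 1 := by linarith
  set A₁ := 180 * (4 * (2 - σ₀ + (2 - σ₁)) / (σ₁ - σ₀) ^ 2) + 4 with hA₁
  have hA₁0 : 0 < A₁ := by
    have : 0 ≤ 2 - σ₀ + (2 - σ₁) := by linarith
    positivity
  set A₂ := 2 * (∑' n, ‖LSeries.term (fun n ↦ (ArithmeticFunction.vonMangoldt n : ℂ))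
    (4 / 3 : ℝ) n‖) + 1 with hA₂
  have hA₂0 : 0 < A₂ := by
    have : 0 ≤ ∑' n, ‖LSeries.term (fun n ↦ (ArithmeticFunction.vonMangoldt n : ℂ))
      (4 / 3 : ℝ) n‖ := tsum_nonneg fun _ ↦ norm_nonneg _
    positivity
  refine ⟨A₂ ^ (3 / 2 : ℝ) * A₁ ^ (2 / (1 - σ₀)), by positivity, ?_⟩
  intro N _ χ X hN hχ hL hX h
  have hlog : 0 < Real.log N := Real.log_pos (by exact_mod_cast (by lia : 1 < N))
  have hd := differentiableOn_logDerivDifference hσ₀ hχ hζ hL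
  have hclosed : IsClosed (Complex.HadamardThreeLines.verticalClosedStrip σ₁ 2) :=
    isClosed_Icc.preimage Complex.continuous_re
  have hcl : closure (Complex.HadamardThreeLines.verticalStrip σ₁ 2) ⊆
      Complex.HadamardThreeLines.verticalClosedStrip σ₁ 2 :=
    closure_minimal (Set.preimage_mono Set.Ioo_subset_Icc_self) hclosed
  have hbd : ∀ s : ℂ, σ₁ ≤ s.re → s.re ≤ 2 → ‖logDerivDifference χ s‖ ≤ A₁ * Real.log N :=
    fun s h1 h2 ↦ norm_logDerivDifference_le hσ₀ h01 (by linarith) hN hχ hζ hL h1 h2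
  have key := Complex.HadamardThreeLines.norm_le_interp_of_mem_verticalClosedStrip'
    (f := logDerivDifference χ) (z := 1) (a := A₁ * Real.log N) (b := A₂ * X ^ (-(2 / 3) : ℝ))
    (l := σ₁) (u := 2) (by linarith)
    (by simp only [Complex.HadamardThreeLines.verticalClosedStrip, Set.mem_preimage,
          Complex.one_re, Set.mem_Icc]; constructor <;> linarith)
    (DifferentiableOn.diffContOnCl (hd.mono fun s hs ↦ h01.trans_le (hcl hs).1))
    ⟨A₁ * Real.log N, by rintro _ ⟨s, hs, rfl⟩; exact hbd s hs.1 hs.2⟩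
    (fun s hs ↦ hbd s (le_of_eq (by simpa using hs.symm)) (by
      rw [show s.re = σ₁ by simpa using hs]; linarith))
    (fun s hs ↦ (norm_logDerivDifference_le_of_re_eq_two hX h (by simpa using hs)).trans (by
      rw [hA₂]; gcongr; linarith))
  have hone : ‖logDerivDifference χ 1‖ = 1 := by simp [logDerivDifference]
  rw [hone, Complex.one_re] at key
  set θ := (1 - σ₁) / (2 - σ₁) with hθ
  have hθ0 : 0 < θ := div_pos (by linarith) (by linarith)
  have hpos : 0 < A₁ * Real.log N := by positivity
  have key2 := Real.rpow_le_rpow zero_le_one key (z := 3 / 2 / θ) (by positivity)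
  rw [Real.one_rpow, Real.mul_rpow (by positivity) (by positivity), ← Real.rpow_mul hpos.le,
    ← Real.rpow_mul (by positivity), show θ * (3 / 2 / θ) = 3 / 2 by field_simp,
    show (1 - θ) * (3 / 2 / θ) = 2 / (1 - σ₀) by
      have a1 : 1 - σ₁ = 3 / 4 * (1 - σ₀) := by rw [hσ₁]; ring
      have a2 : 2 - σ₁ ≠ 0 := by linarith
      have a3 : 1 - σ₀ ≠ 0 := by linarith
      have a4 : 1 - θ = 1 / (2 - σ₁) := by rw [hθ]; field_simp; ring
      rw [a4, hθ, a1]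
      field_simp
      norm_num,
    Real.mul_rpow hA₂0.le (by positivity), ← Real.rpow_mul hX.le,
    show (-(2 / 3) * (3 / 2) : ℝ) = -1 by norm_num, Real.rpow_neg_one,
    Real.mul_rpow hA₁0.le hlog.le, ← mul_assoc, ← div_eq_mul_inv, le_div_iff₀ hX, one_mul] at key2
  linarith

/-- (Conditional on the Weak Generalized Riemann Hypothesis.)  Fix `ε`
with `0 ≤ ε < 1/2`.  Suppose that for every prime `p` and every nontrivial Dirichlet
character `χ` modulo `p`, every zero `s` of `L(s,χ)` with `0 < Re s < 1` satisfies
`1/2 - ε < Re s < 1/2 + ε`, and the same strip condition holds for the nontrivial zeros of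
the Riemann zeta function.  Then there is a constant `C > 0` such that for every prime `p`
and every prime `r` dividing `p - 1`, there is a positive integer
`a ≤ C · (log p)^(4/(1-2ε))` with `a^((p-1)/r) ≢ 1 (mod p)`; i.e. the least `r`-th
nonresidue modulo `p` is at most `C · (log p)^(4/(1-2ε))`. -/
theorem least_nonresidue_bound_of_weak_GRH (ε : ℝ) (hε0 : 0 ≤ ε) (hε : ε < 1 / 2)
    (hL : ∀ (p : ℕ) (hp : p.Prime) (χ : DirichletCharacter ℂ p), χ ≠ 1 →
      ∀ s : ℂ, @DirichletCharacter.LFunction p ⟨hp.ne_zero⟩ χ s = 0 →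
        0 < s.re → s.re < 1 → 1 / 2 - ε < s.re ∧ s.re < 1 / 2 + ε)
    (hzeta : ∀ s : ℂ, riemannZeta s = 0 → 0 < s.re → s.re < 1 →
        1 / 2 - ε < s.re ∧ s.re < 1 / 2 + ε) :
    ∃ C : ℝ, 0 < C ∧ ∀ p r : ℕ, p.Prime → r.Prime → r ∣ p - 1 →
      ∃ a : ℕ, 0 < a ∧ (a : ℝ) ≤ C * Real.log p ^ (4 / (1 - 2 * ε)) ∧
        (a : ZMod p) ^ ((p - 1) / r) ≠ 1 := by
  have hstrip : (1 / 2 : ℝ) ≤ 1 / 2 + ε := by linarith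
  have hζ : ∀ s : ℂ, 1 / 2 + ε < s.re → DirichletCharacter.LFunctionTrivChar₁ 1 s ≠ 0 := by
    intro s hs
    rcases eq_or_ne s 1 with rfl | hne
    · exact DirichletCharacter.LFunctionTrivChar₁_apply_one_ne_zero 1
    · rw [DirichletCharacter.LFunctionTrivChar₁, Function.update_of_ne hne,
        DirichletCharacter.LFunctionTrivChar, DirichletCharacter.LFunction_modOne_eq]
      refine mul_ne_zero (sub_ne_zero.mpr hne) fun h0 ↦ ?_
      rcases le_or_gt 1 s.re with h1 | h1
      · exact riemannZeta_ne_zero_of_one_le_re h1 h0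
      · linarith [(hzeta s h0 (by linarith) h1).2]
  obtain ⟨A, hA, hbound⟩ := exists_forall_le_log_rpow hstrip (by linarith) hζ
  refine ⟨A + 1, by linarith, fun p r hp hr hrp ↦ ?_⟩
  have : Fact p.Prime := ⟨hp⟩
  have hp3 : 3 ≤ p := by
    rcases hp.two_le.eq_or_lt with rfl | h
    · exact absurd (Nat.dvd_one.mp hrp) hr.ne_one
    · exact h
  have hlog : 0 < Real.log p := Real.log_pos (by exact_mod_cast hp.one_lt)
  obtain ⟨χ, hχ, hres⟩ := exists_dirichletCharacter_ne_one_of_dvd hr hrp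
  have hLne : ∀ s : ℂ, 1 / 2 + ε < s.re → χ.LFunction s ≠ 0 := by
    intro s hs h0
    rcases le_or_gt 1 s.re with h1 | h1
    · exact DirichletCharacter.LFunction_ne_zero_of_one_le_re χ (.inl hχ) h1 h0
    · linarith [(hL p hp χ hχ s h0 (by linarith) h1).2]
  by_contra! hcon
  have hpow : 0 < Real.log p ^ (4 / (1 - 2 * ε)) := by positivity
  have hle := hbound p χ ((A + 1) * Real.log p ^ (4 / (1 - 2 * ε))) hp3 hχ hLne (by positivity)
    fun n hn hnX ↦ hres _ (hcon n hn hnX)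
  have hexp : 2 / (1 - (1 / 2 + ε)) = 4 / (1 - 2 * ε) := by
    have h1 : 1 - 2 * ε ≠ 0 := by linarith
    have h2 : 1 - (1 / 2 + ε) ≠ 0 := by linarith
    rw [div_eq_div_iff h2 h1]
    ring
  rw [hexp] at hle
  linarith
end

section
/- (Conditional bound for ψ(x,χ).) Fix ε with 0 ≤ ε < 1/2. There is an absolute constant C > 0 such that: for every prime p and every nontrivial Dirichlet character χ modulo p, if every zero s of L(s,χ) with 0 < Re(s) < 1 satisfies Re(s) ≤ 1/2 + ε, then for all real x ≥ 2, |ψ(x,χ)| ≤ C·x^{1/2+ε}·(log(p·x))², where ψ(x,χ) = Σ_{n ≤ x} Λ(n)·χ(n). -/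
open Complex

/-- A nonvanishing function on a disc whose modulus exceeds its value at the centre by at most a
factor `exp A` has logarithmic derivative `O(A)` on smaller discs. -/
lemma norm_logDeriv_le_of_nonvanishing {g : ℂ → ℂ} (hg : Differentiable ℂ g) {r R A : ℝ}
    (hr : 0 ≤ r) (hrR : r < R) (hA : 0 < A) (hne : ∀ z, ‖z‖ < R → g z ≠ 0)
    (hle : ∀ z, ‖z‖ < R → ‖g z‖ ≤ Real.exp A * ‖g 0‖) {z : ℂ} (hz : ‖z‖ ≤ r) :
    ‖logDeriv g z‖ ≤ 8 * A * R / (R - r) ^ 2 := by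
  have hR : 0 < R := hr.trans_lt hrR
  have h0 : g 0 ≠ 0 := hne 0 (by simpa using hR)
  have hd : DifferentiableOn ℂ (logDeriv g) (Metric.ball 0 R) := by
    intro w hw
    have hw' : g w ≠ 0 := hne w (by simpa using hw)
    have h1 : DifferentiableAt ℂ (deriv g) w := (hg.analyticAt w).deriv.differentiableAt
    exact (h1.div (hg w) hw').differentiableWithinAt
  obtain ⟨h, hh0, hh⟩ := hd.isExactOn_ball.with_val_at 0 0
  have hexp : ∀ w ∈ Metric.ball (0 : ℂ) R, g w * Complex.exp (-h w) = g 0 := by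
    intro w hw
    have hder : ∀ v ∈ Metric.ball (0 : ℂ) R,
        HasDerivAt (fun v => g v * Complex.exp (-h v)) 0 v := by
      intro v hv
      have := (hg v).hasDerivAt.mul ((hh v hv).neg.cexp)
      have h1 : g v * logDeriv g v = deriv g v := by
        rw [logDeriv_apply]
        exact mul_div_cancel₀ _ (hne v (by simpa using hv))
      refine this.congr_deriv ?_
      rw [← h1]
      ring
    have hconst := (convex_ball (0 : ℂ) R).is_const_of_fderivWithin_eq_zero (𝕜 := ℂ)
      (f := fun v => g v * Complex.exp (-h v))
      (fun v hv => (hder v hv).differentiableAt.differentiableWithinAt)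
      (fun v hv => by
        rw [fderivWithin_of_isOpen Metric.isOpen_ball hv]
        ext
        simpa using (hder v hv).deriv) hw (Metric.mem_ball_self hR)
    simpa [hh0] using hconst
  have hre : Set.MapsTo h (Metric.ball 0 R) {z | z.re ≤ A} := by
    intro w hw
    have h1 : ‖g w‖ = ‖g 0‖ * Real.exp (h w).re := by
      have := congrArg norm (hexp w hw)
      rw [norm_mul, Complex.norm_exp] at this
      rw [← this, mul_assoc, ← Real.exp_add]
      simp
    have h2 := hle w (by simpa using hw)
    rw [h1, mul_comm] at h2
    exact Real.exp_le_exp.mp (le_of_mul_le_mul_right h2 (norm_pos_iff.mpr h0))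
  have hdh : DifferentiableOn ℂ h (Metric.ball 0 R) := fun w hw =>
    (hh w hw).differentiableAt.differentiableWithinAt
  have hzR : z ∈ Metric.ball (0 : ℂ) R := by simpa using hz.trans_lt hrR
  rw [← (hh z hzR).deriv]
  have hb := norm_deriv_le_of_forall_mem_sphere_norm_le (c := z) (R := (R - r) / 2) (f := h)
    (C := 4 * A * R / (R - r)) (by linarith)
    (by
      refine DifferentiableOn.diffContOnCl (hdh.mono ?_)
      refine Metric.closure_ball_subset_closedBall.trans fun w hw => ?_
      rw [Metric.mem_closedBall, dist_eq_norm] at hw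
      rw [mem_ball_zero_iff]
      have := norm_le_norm_add_norm_sub' w z
      linarith)
    (by
      intro w hw
      rw [mem_sphere_iff_norm] at hw
      have h1 : ‖w‖ ≤ (r + R) / 2 := by
        have := norm_le_norm_add_norm_sub' w z
        linarith
      have h2 := borelCaratheodory_zero hA hdh hre hR (z := w)
        (by rw [mem_ball_zero_iff]; linarith) hh0
      refine h2.trans ?_
      rw [div_le_div_iff₀ (by linarith) (by linarith)]
      have : 0 ≤ ‖w‖ := norm_nonneg w
      nlinarith [mul_nonneg hA.le (mul_nonneg this (sub_nonneg.mpr hrR.le)),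
        mul_nonneg hA.le (mul_nonneg hR.le (sub_nonneg.mpr h1)),
        mul_nonneg hA.le (mul_nonneg (sub_nonneg.mpr h1) (sub_nonneg.mpr hrR.le))])
  refine hb.trans (le_of_eq ?_)
  have : R - r ≠ 0 := by linarith
  field_simp
  ring

/-- Removal of the zeros of an entire function from a disc by Blaschke factors. -/
lemma exists_zeros_logDeriv_eq {r R M : ℝ} (hr : 0 < r) (hrR : r < R) (n : ℕ) {f : ℂ → ℂ}
    (hf : Differentiable ℂ f) (hM : ∀ z, ‖z‖ ≤ R → ‖f z‖ ≤ M) (hn : M < (R / r) ^ n * ‖f 0‖) :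
    ∃ (S : Multiset ℂ) (g : ℂ → ℂ), S.card ≤ n ∧ (∀ ρ ∈ S, ‖ρ‖ ≤ r ∧ f ρ = 0) ∧
      Differentiable ℂ g ∧ (∀ z, ‖z‖ ≤ r → g z ≠ 0) ∧ (∀ z, ‖z‖ ≤ R → ‖g z‖ ≤ M) ∧
      ‖f 0‖ ≤ ‖g 0‖ ∧ ∀ z, ‖z‖ < R → f z ≠ 0 → logDeriv f z = logDeriv g z +
        (S.map fun ρ => 1 / (z - ρ) + (starRingEnd ℂ) ρ / (R ^ 2 - (starRingEnd ℂ) ρ * z)).sum := by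
  have hR : 0 < R := hr.trans hrR
  induction n generalizing f with
  | zero =>
    have := hM 0 (by simpa using hR.le)
    simp only [pow_zero, one_mul] at hn
    linarith
  | succ n ih =>
    by_cases hz : ∀ z, ‖z‖ ≤ r → f z ≠ 0
    · exact ⟨0, f, by simp, by simp, hf, hz, hM, le_rfl, by simp⟩
    push Not at hz
    obtain ⟨ρ, hρ, hfρ⟩ := hz
    have hf0 : f 0 ≠ 0 := by
      intro h0
      have := (norm_nonneg _).trans (hM 0 (by simpa using hR.le))
      rw [h0, norm_zero, mul_zero] at hn
      linarith
    have hρ0 : ρ ≠ 0 := by rintro rfl; exact hf0 hfρ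
    set G : ℂ → ℂ := fun z => dslope f ρ z * ((R ^ 2 - (starRingEnd ℂ) ρ * z) / R) with hG
    have hGd : Differentiable ℂ G := by
      have h1 : Differentiable ℂ (dslope f ρ) := by
        rw [← differentiableOn_univ] at hf ⊢
        exact (differentiableOn_dslope Filter.univ_mem).mpr hf
      fun_prop
    have hden : ∀ z, ‖z‖ < R → (R : ℂ) ^ 2 - (starRingEnd ℂ) ρ * z ≠ 0 := by
      intro z hz h
      have h1 : ‖(R : ℂ) ^ 2‖ = ‖(starRingEnd ℂ) ρ * z‖ := by rw [sub_eq_zero.mp h]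
      rw [norm_pow, norm_mul, RCLike.norm_conj, Complex.norm_real, Real.norm_of_nonneg hR.le] at h1
      nlinarith [norm_nonneg z, norm_nonneg ρ]
    have hR' : (R : ℂ) ≠ 0 := by exact_mod_cast hR.ne'
    have hfG : ∀ z, f z * (R ^ 2 - (starRingEnd ℂ) ρ * z) = G z * (R * (z - ρ)) := by
      intro z
      have h1 : (z - ρ) * dslope f ρ z = f z := by
        have := sub_smul_dslope f ρ z
        simpa [hfρ] using this
      rw [← h1, hG]
      field_simp
    clear_value G
    have hGM : ∀ z, ‖z‖ ≤ R → ‖G z‖ ≤ M := by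
      intro z hz
      refine norm_le_of_forall_mem_frontier_norm_le (U := Metric.ball (0 : ℂ) R)
        Metric.isBounded_ball hGd.diffContOnCl ?_ (by
          rw [closure_ball _ hR.ne']; simpa using hz)
      rw [frontier_ball _ hR.ne']
      intro w hw
      rw [mem_sphere_iff_norm, sub_zero] at hw
      have hwρ : w - ρ ≠ 0 := by
        intro h
        rw [sub_eq_zero.mp h] at hw
        linarith
      have h1 : ‖(R : ℂ) ^ 2 - (starRingEnd ℂ) ρ * w‖ = R * ‖w - ρ‖ := by
        have h2 : (R : ℂ) ^ 2 = w * (starRingEnd ℂ) w := by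
          rw [Complex.mul_conj, Complex.normSq_eq_norm_sq, hw]; push_cast; rfl
        rw [h2, mul_comm _ w, ← mul_sub, ← map_sub, norm_mul, RCLike.norm_conj, hw]
      have h2 := congrArg norm (hfG w)
      rw [norm_mul, norm_mul, norm_mul, h1, Complex.norm_real, Real.norm_of_nonneg hR.le] at h2
      have h3 : R * ‖w - ρ‖ ≠ 0 := (mul_pos hR (norm_pos_iff.mpr hwρ)).ne'
      rw [← mul_right_cancel₀ h3 h2]
      exact hM w hw.le
    have hG0 : ‖f 0‖ * R = ‖G 0‖ * ‖ρ‖ := by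
      have h2 := congrArg norm (hfG 0)
      simp only [mul_zero, sub_zero, zero_sub, norm_mul, norm_neg, norm_pow, Complex.norm_real,
        Real.norm_of_nonneg hR.le] at h2
      have : (‖f 0‖ * R - ‖G 0‖ * ‖ρ‖) * R = 0 := by linarith
      rcases mul_eq_zero.mp this with h | h
      · linarith
      · exact absurd h hR.ne'
    have hG0' : R / r * ‖f 0‖ ≤ ‖G 0‖ := by
      rw [div_mul_eq_mul_div, div_le_iff₀ hr, mul_comm, hG0]
      gcongr
    have hG0'' : ‖f 0‖ ≤ ‖G 0‖ := by
      refine le_trans ?_ hG0'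
      have : 1 ≤ R / r := by rw [one_le_div hr]; exact hrR.le
      nlinarith [norm_nonneg (f 0)]
    obtain ⟨S, g, hS, hSz, hg, hgne, hgM, hg0, hlog⟩ := ih hGd hGM (by
      refine hn.trans_le ?_
      rw [pow_succ, mul_assoc]
      gcongr)
    refine ⟨ρ ::ₘ S, g, by simpa using hS, ?_, hg, hgne, hgM, hG0''.trans hg0, ?_⟩
    · intro w hw
      rcases Multiset.mem_cons.mp hw with rfl | hw
      · exact ⟨hρ, hfρ⟩
      · obtain ⟨h1, h2⟩ := hSz w hw
        refine ⟨h1, ?_⟩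
        have := hfG w
        rw [h2, zero_mul] at this
        exact (mul_eq_zero.mp this).resolve_right (hden w (h1.trans_lt hrR))
    · intro z hz hfz
      have hzρ : z - ρ ≠ 0 := by
        intro h
        rw [sub_eq_zero.mp h] at hfz
        exact hfz hfρ
      have hGz : G z ≠ 0 := by
        intro h
        have := hfG z
        rw [h, zero_mul] at this
        exact (mul_ne_zero hfz (hden z hz)) this
      have h1 : logDeriv (fun z => f z * (R ^ 2 - (starRingEnd ℂ) ρ * z)) z =
          logDeriv (fun z => G z * (R * (z - ρ))) z := by
        rw [funext hfG]
      rw [logDeriv_mul z hfz (hden z hz) (hf z) (by fun_prop),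
        logDeriv_mul (f := G) (g := fun z => (R : ℂ) * (z - ρ)) z hGz (mul_ne_zero hR' hzρ)
          (hGd z) (by fun_prop),
        hlog z hz hGz, logDeriv_apply (fun z => (R : ℂ) ^ 2 - (starRingEnd ℂ) ρ * z),
        logDeriv_apply (fun z => (R : ℂ) * (z - ρ))] at h1
      have h2 : deriv (fun z => (R : ℂ) ^ 2 - (starRingEnd ℂ) ρ * z) z = -(starRingEnd ℂ) ρ := by simp
      have h3 : deriv (fun z => (R : ℂ) * (z - ρ)) z = R := by simp
      rw [h2, h3] at h1
      rw [Multiset.map_cons, Multiset.sum_cons]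
      have h4 : (R : ℂ) / (R * (z - ρ)) = 1 / (z - ρ) := by field_simp
      rw [h4, neg_div] at h1
      linear_combination h1

/-- Local expansion of the logarithmic derivative over nearby zeros. -/
lemma exists_local_logDeriv_expansion {f : ℂ → ℂ} (hf : Differentiable ℂ f) {A : ℝ} (hA : 1 ≤ A)
    (hf0 : f 0 ≠ 0) (hle : ∀ z, ‖z‖ ≤ 9 / 5 → ‖f z‖ ≤ Real.exp A * ‖f 0‖) :
    ∃ S : Multiset ℂ, (S.card : ℝ) ≤ 19 * A ∧ (∀ ρ ∈ S, ‖ρ‖ ≤ 17 / 10 ∧ f ρ = 0) ∧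
      ∀ z, ‖z‖ ≤ 8 / 5 → f z ≠ 0 →
        ‖logDeriv f z - (S.map fun ρ => 1 / (z - ρ)).sum‖ ≤ 2000 * A := by
  have hf0' : 0 < ‖f 0‖ := norm_pos_iff.mpr hf0
  set n := ⌊18 * A⌋₊ + 1 with hn
  have hn1 : 18 * A < n := by rw [hn]; push_cast; exact Nat.lt_floor_add_one _
  have hn2 : (n : ℝ) ≤ 19 * A := by
    rw [hn]; push_cast
    have := Nat.floor_le (show 0 ≤ 18 * A by linarith)
    linarith
  have hpow : Real.exp A < ((9 / 5 : ℝ) / (17 / 10)) ^ n := by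
    have h1 : (1 : ℝ) / 18 ≤ Real.log ((9 / 5 : ℝ) / (17 / 10)) := by
      have := Real.one_sub_inv_le_log_of_pos (show (0 : ℝ) < (9 / 5 : ℝ) / (17 / 10) by norm_num)
      norm_num at this ⊢
      linarith
    rw [← Real.exp_log (show (0 : ℝ) < (9 / 5 : ℝ) / (17 / 10) by norm_num), ← Real.exp_nat_mul]
    apply Real.exp_lt_exp.mpr
    nlinarith
  obtain ⟨S, g, hS, hSz, hg, hgne, hgM, hg0, hlog⟩ :=
    exists_zeros_logDeriv_eq (r := 17 / 10) (R := 9 / 5) (M := Real.exp A * ‖f 0‖) (by norm_num)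
      (by norm_num) n hf hle (by gcongr)
  refine ⟨S, (Nat.cast_le.mpr hS).trans hn2, hSz, fun z hz hfz => ?_⟩
  have hg' : ‖logDeriv g z‖ ≤ 8 * A * (17 / 10) / (17 / 10 - 8 / 5) ^ 2 :=
    norm_logDeriv_le_of_nonvanishing hg (by norm_num) (by norm_num) (by linarith)
      (fun w hw => hgne w hw.le)
      (fun w hw => (hgM w (by linarith)).trans (by gcongr)) hz
  have hsum : ∀ T : Multiset ℂ, (∀ ρ ∈ T, ‖ρ‖ ≤ 17 / 10) →
      ‖(T.map fun ρ => 1 / (z - ρ) + (starRingEnd ℂ) ρ /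
        (((9 / 5 : ℝ) : ℂ) ^ 2 - (starRingEnd ℂ) ρ * z)).sum -
        (T.map fun ρ => 1 / (z - ρ)).sum‖ ≤ T.card * 4 := by
    intro T hT
    induction T using Multiset.induction_on with
    | empty => simp
    | cons ρ T ih =>
      have h1 := ih fun w hw => hT w (Multiset.mem_cons_of_mem hw)
      have h2 := hT ρ (Multiset.mem_cons_self ρ T)
      have h3 : ‖(starRingEnd ℂ) ρ / (((9 / 5 : ℝ) : ℂ) ^ 2 - (starRingEnd ℂ) ρ * z)‖ ≤ 4 := by
        have h4 : (1 : ℝ) / 2 ≤ ‖((9 / 5 : ℝ) : ℂ) ^ 2 - (starRingEnd ℂ) ρ * z‖ := by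
          have h5 := norm_sub_norm_le (((9 / 5 : ℝ) : ℂ) ^ 2) ((starRingEnd ℂ) ρ * z)
          rw [norm_pow, norm_mul, RCLike.norm_conj, Complex.norm_real,
            Real.norm_of_nonneg (by norm_num)] at h5
          have : ‖ρ‖ * ‖z‖ ≤ 17 / 10 * (8 / 5) := by gcongr
          norm_num at h5 this ⊢
          linarith
        rw [norm_div, RCLike.norm_conj, div_le_iff₀ (by linarith)]
        linarith
      simp only [Multiset.map_cons, Multiset.sum_cons, Multiset.card_cons]
      push_cast
      rw [add_sub_add_comm, add_sub_cancel_left, add_mul, one_mul, add_comm]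
      exact (norm_add_le _ _).trans (by push_cast at *; linarith)
  have h1 := hsum S fun w hw => (hSz w hw).1
  have hcard : (S.card : ℝ) ≤ 19 * A := (Nat.cast_le.mpr hS).trans hn2
  rw [hlog z (by linarith) hfz, add_sub_assoc]
  refine (norm_add_le _ _).trans ?_
  norm_num at hg' h1 ⊢
  linarith

section VerticalStrip

variable {L : ℂ → ℂ} {A : ℝ → ℝ} {θ : ℝ}

/-- Vertical-strip version of the local expansion, for an entire function whose zeros in the
half plane `1 / 5 < re s` satisfy `re s ≤ θ`. -/
lemma exists_strip_logDeriv_expansion (hL : Differentiable ℂ L) (hA : ∀ t, 1 ≤ A t)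
    (h2 : ∀ t : ℝ, L (2 + t * I) ≠ 0)
    (hle : ∀ (t : ℝ) z, ‖z‖ ≤ 9 / 5 → ‖L (2 + t * I + z)‖ ≤ Real.exp (A t) * ‖L (2 + t * I)‖)
    (hzero : ∀ s : ℂ, 1 / 5 < s.re → L s = 0 → s.re ≤ θ) (hθ : 1 / 2 ≤ θ) (t₀ : ℝ) :
    ∃ S : Multiset ℂ, (S.card : ℝ) ≤ 19 * A t₀ ∧ (∀ ρ ∈ S, ρ.re ≤ θ) ∧
      ∀ σ t : ℝ, θ < σ → σ ≤ 2 → |t - t₀| ≤ 1 / 2 →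
        ‖logDeriv L (σ + t * I) - (S.map fun ρ => 1 / (σ + t * I - ρ)).sum‖ ≤ 2000 * A t₀ := by
  obtain ⟨S, hS, hSz, hlog⟩ := exists_local_logDeriv_expansion
    (f := fun z => L (2 + t₀ * I + z)) (by fun_prop) (hA t₀) (by simpa using h2 t₀)
    (by simpa using hle t₀)
  refine ⟨S.map fun ρ => 2 + t₀ * I + ρ, by simpa using hS, ?_, ?_⟩
  · intro ρ hρ
    obtain ⟨w, hw, rfl⟩ := Multiset.mem_map.mp hρ
    obtain ⟨h1, h3⟩ := hSz w hw
    refine hzero _ ?_ h3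
    have := (abs_le.mp ((abs_re_le_norm w).trans h1)).1
    simp
    linarith
  · intro σ t hσ hσ2 ht
    have hz : ‖(σ : ℂ) + t * I - (2 + t₀ * I)‖ ≤ 8 / 5 := by
      rw [abs_le] at ht
      refine abs_le_of_sq_le_sq' ?_ (by norm_num) |>.2
      rw [← Complex.normSq_eq_norm_sq, Complex.normSq_apply]
      simp
      nlinarith
    have hne : L (2 + t₀ * I + (σ + t * I - (2 + t₀ * I))) ≠ 0 := by
      rw [add_sub_cancel]
      intro h
      have := hzero _ (by simp; linarith) h
      simp at this
      linarith
    have := hlog _ hz hne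
    rw [logDeriv_apply, deriv_comp_const_add, ← logDeriv_apply, add_sub_cancel] at this
    rw [Multiset.map_map]
    convert this using 5
    simp
    ring

lemma norm_logDeriv_le_strip (hL : Differentiable ℂ L) (hA : ∀ t, 1 ≤ A t)
    (h2 : ∀ t : ℝ, L (2 + t * I) ≠ 0)
    (hle : ∀ (t : ℝ) z, ‖z‖ ≤ 9 / 5 → ‖L (2 + t * I + z)‖ ≤ Real.exp (A t) * ‖L (2 + t * I)‖)
    (hzero : ∀ s : ℂ, 1 / 5 < s.re → L s = 0 → s.re ≤ θ) (hθ : 1 / 2 ≤ θ)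
    {σ : ℝ} (hσ : θ < σ) (hσ2 : σ ≤ 2) (t : ℝ) :
    ‖logDeriv L (σ + t * I)‖ ≤ (2000 + 19 / (σ - θ)) * A t := by
  obtain ⟨S, hS, hSz, hlog⟩ := exists_strip_logDeriv_expansion hL hA h2 hle hzero hθ t
  have h1 := hlog σ t hσ hσ2 (by simp)
  have hsum : ∀ T : Multiset ℂ, (∀ ρ ∈ T, ρ.re ≤ θ) →
      ‖(T.map fun ρ => 1 / (σ + t * I - ρ)).sum‖ ≤ T.card * (1 / (σ - θ)) := by
    intro T hT
    induction T using Multiset.induction_on with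
    | empty => simp
    | cons ρ T ih =>
      have h1 := ih fun w hw => hT w (Multiset.mem_cons_of_mem hw)
      have h2 := hT ρ (Multiset.mem_cons_self ρ T)
      have h3 : ‖1 / (σ + t * I - ρ)‖ ≤ 1 / (σ - θ) := by
        rw [norm_div, norm_one]
        refine one_div_le_one_div_of_le (by linarith) ?_
        refine le_trans ?_ (re_le_norm _)
        simp
        linarith
      simp only [Multiset.map_cons, Multiset.sum_cons, Multiset.card_cons]
      refine (norm_add_le _ _).trans ?_
      push_cast
      linarith
  have h3 := hsum S hSz
  have h4 : S.card * (1 / (σ - θ)) ≤ 19 * A t * (1 / (σ - θ)) := by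
    have : 0 ≤ 1 / (σ - θ) := by
      have : 0 < σ - θ := by linarith
      positivity
    gcongr
  have h5 := norm_le_norm_add_norm_sub' (logDeriv L (σ + t * I))
    (S.map fun ρ => 1 / (σ + t * I - ρ)).sum
  calc _ ≤ 19 * A t * (1 / (σ - θ)) + 2000 * A t := by linarith
    _ = _ := by ring

lemma integral_re_one_div_sub_le {σ : ℝ} {ρ : ℂ} (hρ : ρ.re < σ) {a b : ℝ} :
    ∫ t in a..b, (1 / ((σ : ℂ) + t * I - ρ)).re ≤ Real.pi := by
  have hd : 0 < σ - ρ.re := by linarith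
  have hder : ∀ t : ℝ, HasDerivAt (fun t : ℝ => Real.arctan ((t - ρ.im) / (σ - ρ.re)))
      (1 / ((σ : ℂ) + t * I - ρ)).re t := by
    intro t
    have h1 : HasDerivAt (fun t : ℝ => (t - ρ.im) / (σ - ρ.re)) (1 / (σ - ρ.re)) t :=
      ((hasDerivAt_id t).sub_const _).div_const _
    refine h1.arctan.congr_deriv ?_
    rw [one_div (_ : ℂ), Complex.inv_re, Complex.normSq_apply]
    have : (σ - ρ.re) * (σ - ρ.re) + (t - ρ.im) * (t - ρ.im) ≠ 0 := by nlinarith [sq_nonneg (t - ρ.im)]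
    simp
    field_simp
  have hcont : Continuous fun t : ℝ => (1 / ((σ : ℂ) + t * I - ρ)).re := by
    refine Complex.continuous_re.comp (Continuous.div continuous_const (by fun_prop) ?_)
    intro t h
    have := congrArg Complex.re h
    simp at this
    linarith
  rw [intervalIntegral.integral_eq_sub_of_hasDerivAt (fun t _ => hder t)
    (hcont.intervalIntegrable _ _)]
  have h1 := Real.arctan_lt_pi_div_two ((b - ρ.im) / (σ - ρ.re))
  have h2 := Real.neg_pi_div_two_lt_arctan ((a - ρ.im) / (σ - ρ.re))
  linarith

lemma continuous_logDeriv_vertical (hL : Differentiable ℂ L)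
    {σ : ℝ} (hne : ∀ t : ℝ, L (σ + t * I) ≠ 0) :
    Continuous fun t : ℝ => logDeriv L (σ + t * I) := by
  have h1 : Continuous (deriv L) := (hL.contDiff (n := 1)).continuous_deriv le_rfl
  have := hL.continuous
  exact Continuous.div (by fun_prop) (by fun_prop) hne

/-- The real part of the logarithmic derivative is small on average, uniformly up to the edge of
the zero-free half plane. -/
lemma integral_abs_re_logDeriv_le (hL : Differentiable ℂ L) (hA : ∀ t, 1 ≤ A t)
    (h2 : ∀ t : ℝ, L (2 + t * I) ≠ 0)
    (hle : ∀ (t : ℝ) z, ‖z‖ ≤ 9 / 5 → ‖L (2 + t * I + z)‖ ≤ Real.exp (A t) * ‖L (2 + t * I)‖)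
    (hzero : ∀ s : ℂ, 1 / 5 < s.re → L s = 0 → s.re ≤ θ) (hθ : 1 / 2 ≤ θ)
    {σ : ℝ} (hσ : θ < σ) (hσ2 : σ ≤ 2) (k : ℝ) :
    ∫ t in k..(k + 1), |(logDeriv L (σ + t * I)).re| ≤ 2100 * A (k + 1 / 2) := by
  obtain ⟨S, hS, hSz, hlog⟩ := exists_strip_logDeriv_expansion hL hA h2 hle hzero hθ (k + 1 / 2)
  have hsum : ∀ T : Multiset ℂ, (∀ ρ ∈ T, ρ.re ≤ θ) →
      (Continuous fun t : ℝ => ((T.map fun ρ => 1 / ((σ : ℂ) + t * I - ρ)).sum).re) ∧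
      (∀ t : ℝ, 0 ≤ ((T.map fun ρ => 1 / ((σ : ℂ) + t * I - ρ)).sum).re) ∧
      ∫ t in k..(k + 1), ((T.map fun ρ => 1 / ((σ : ℂ) + t * I - ρ)).sum).re
        ≤ T.card * Real.pi := by
    intro T hT
    induction T using Multiset.induction_on with
    | empty => simp [continuous_const]
    | cons ρ T ih =>
      obtain ⟨ih1, ih2, ih3⟩ := ih fun w hw => hT w (Multiset.mem_cons_of_mem hw)
      have hρ : ρ.re < σ := (hT ρ (Multiset.mem_cons_self ρ T)).trans_lt hσ
      have hcont : Continuous fun t : ℝ => (1 / ((σ : ℂ) + t * I - ρ)).re := by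
        refine Complex.continuous_re.comp (Continuous.div continuous_const (by fun_prop) ?_)
        intro t h
        have := congrArg Complex.re h
        simp at this
        linarith
      simp only [Multiset.map_cons, Multiset.sum_cons, Multiset.card_cons, Complex.add_re]
      refine ⟨hcont.add ih1, fun t => add_nonneg ?_ (ih2 t), ?_⟩
      · rw [one_div, Complex.inv_re]
        refine div_nonneg ?_ (Complex.normSq_nonneg _)
        simp
        linarith
      · rw [intervalIntegral.integral_add (hcont.intervalIntegrable _ _)
          (ih1.intervalIntegrable _ _)]
        push_cast
        have := integral_re_one_div_sub_le hρ (a := k) (b := k + 1)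
        linarith
  obtain ⟨h3, h4, h5⟩ := hsum S hSz
  have hne : ∀ t : ℝ, L (σ + t * I) ≠ 0 := by
    intro t h
    have := hzero _ (by simp; linarith) h
    simp at this
    linarith
  have hcont := continuous_logDeriv_vertical hL hne
  calc ∫ t in k..(k + 1), |(logDeriv L (σ + t * I)).re|
      ≤ ∫ t in k..(k + 1), (((S.map fun ρ => 1 / ((σ : ℂ) + t * I - ρ)).sum).re +
          2000 * A (k + 1 / 2)) := by
        refine intervalIntegral.integral_mono_on (by linarith)
          ((by fun_prop : Continuous _).intervalIntegrable _ _)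
          ((by fun_prop : Continuous _).intervalIntegrable _ _) fun t ht => ?_
        have h6 := hlog σ t hσ hσ2 (by rw [abs_le]; constructor <;> linarith [ht.1, ht.2])
        have h7 := (abs_re_le_norm _).trans h6
        rw [Complex.sub_re] at h7
        have h8 := h4 t
        rw [abs_le] at h7 ⊢
        constructor <;> linarith
    _ ≤ S.card * Real.pi + 2000 * A (k + 1 / 2) := by
        rw [intervalIntegral.integral_add (h3.intervalIntegrable _ _)
          (continuous_const.intervalIntegrable _ _)]
        simp only [intervalIntegral.integral_const, add_sub_cancel_left, one_smul]
        linarith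
    _ ≤ _ := by
        have := Real.pi_le_four
        have h9 := hA (k + 1 / 2)
        have : S.card * Real.pi ≤ 19 * A (k + 1 / 2) * 4 := by gcongr
        linarith

end VerticalStrip

namespace DirichletCharacter

variable {N : ℕ} [NeZero N] {χ : DirichletCharacter ℂ N}

lemma norm_sum_range_le (hχ : χ ≠ 1) (m : ℕ) : ‖∑ i ∈ Finset.range m, χ (i : ZMod N)‖ ≤ N := by
  induction m using Nat.strong_induction_on with
  | _ m ih =>
    rcases le_or_gt m N with hm | hm
    · calc _ ≤ ∑ i ∈ Finset.range m, ‖χ (i : ZMod N)‖ := norm_sum_le _ _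
        _ ≤ ∑ i ∈ Finset.range m, 1 := Finset.sum_le_sum fun i _ => χ.norm_le_one _
        _ ≤ N := by simpa using hm
    · have h1 : ∑ i ∈ Finset.range N, χ (i : ZMod N) = 0 := by
        rw [← MulChar.sum_eq_zero_of_ne_one hχ]
        refine Finset.sum_nbij' (fun i => (i : ZMod N)) ZMod.val (by simp)
          (fun a _ => by simpa using ZMod.val_lt a) (fun i hi => ?_) (fun a _ => by simp) (by simp)
        exact ZMod.val_cast_of_lt (by simpa using hi)
      obtain ⟨k, rfl⟩ := Nat.exists_eq_add_of_le hm.le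
      rw [Finset.sum_range_add, h1, zero_add]
      simpa using ih k (by have := NeZero.pos N; omega)

lemma norm_sum_Icc_le_s11 (hχ : χ ≠ 1) (m : ℕ) :
    ‖∑ i ∈ Finset.Icc 1 m, χ (i : ZMod N)‖ ≤ 2 * N := by
  have h1 : ∑ i ∈ Finset.range (m + 1), χ (i : ZMod N) =
      χ ((0 : ℕ) : ZMod N) + ∑ i ∈ Finset.Icc 1 m, χ (i : ZMod N) := by
    rw [Finset.range_eq_Ico, Finset.sum_eq_sum_Ico_succ_bot (by omega)]
    rfl
  rw [← sub_eq_iff_eq_add'] at h1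
  rw [← h1]
  refine (norm_sub_le _ _).trans ?_
  have h2 := norm_sum_range_le hχ (m + 1)
  have h3 := χ.norm_le_one ((0 : ℕ) : ZMod N)
  have h4 : (1 : ℝ) ≤ N := by exact_mod_cast NeZero.one_le
  linarith

lemma LFunction_eq_mul_integral (hχ : χ ≠ 1) {s : ℂ} (hs : 0 < s.re) :
    LFunction χ s = s * ∫ t in Set.Ioi (1 : ℝ),
      (∑ k ∈ Finset.Icc 1 ⌊t⌋₊, χ (k : ZMod N)) * (t : ℂ) ^ (-(s + 1)) := by
  set S : ℝ → ℂ := fun t => ∑ k ∈ Finset.Icc 1 ⌊t⌋₊, χ (k : ZMod N) with hS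
  set g : ℝ → ℂ := (Set.Ioi (1 : ℝ)).indicator S with hg
  have hSm : Measurable S :=
    (measurable_from_nat (f := fun n => ∑ k ∈ Finset.Icc 1 n, χ (k : ZMod N))).comp
      Nat.measurable_floor
  have hgm : Measurable g := hSm.indicator measurableSet_Ioi
  have hgb : ∀ t, ‖g t‖ ≤ 2 * N := fun t =>
    (norm_indicator_le_norm_self _ _).trans (norm_sum_Icc_le_s11 hχ _)
  have hint : ∀ z : ℂ, mellin g (-z) = ∫ t in Set.Ioi (1 : ℝ), S t * (t : ℂ) ^ (-(z + 1)) := by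
    intro z
    rw [mellin, hg]
    have hsmul : ∀ t : ℝ, (t : ℂ) ^ (-z - 1) • (Set.Ioi (1 : ℝ)).indicator S t =
        (Set.Ioi (1 : ℝ)).indicator (fun t => (t : ℂ) ^ (-z - 1) • S t) t := fun t => by
      by_cases ht : t ∈ Set.Ioi (1 : ℝ) <;> simp [ht]
    simp_rw [hsmul]
    rw [MeasureTheory.setIntegral_indicator measurableSet_Ioi]
    have : Set.Ioi (0 : ℝ) ∩ Set.Ioi 1 = Set.Ioi 1 :=
      Set.inter_eq_right.mpr (Set.Ioi_subset_Ioi zero_le_one)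
    rw [this]
    refine MeasureTheory.integral_congr_ae (Filter.Eventually.of_forall fun t => ?_)
    simp only [smul_eq_mul]
    rw [mul_comm, neg_add']
  have hdiff : ∀ z : ℂ, 0 < z.re → DifferentiableAt ℂ (mellin g) (-z) := by
    intro z hz
    refine mellin_differentiableAt_of_isBigO_rpow (a := 0) (b := -z.re - 1) ?_ ?_ ?_ ?_ ?_
    · refine MeasureTheory.LocallyIntegrable.locallyIntegrableOn ?_ _
      refine (MeasureTheory.locallyIntegrable_const ((2 * N : ℝ))).mono hgm.aestronglyMeasurable ?_
      exact Filter.Eventually.of_forall fun t => (hgb t).trans (le_abs_self _)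
    · refine Asymptotics.IsBigO.of_bound (2 * N) (Filter.Eventually.of_forall fun t => ?_)
      simpa using hgb t
    · simpa using hz
    · refine Asymptotics.IsBigO.of_bound 0 ?_
      have : Set.Ioo (0 : ℝ) 1 ∈ nhdsWithin 0 (Set.Ioi 0) := Ioo_mem_nhdsGT one_pos
      filter_upwards [this] with t ht
      have : g t = 0 := Set.indicator_of_notMem (by simpa using ht.2.le) _
      simp [this]
    · simp
  have hdom : IsOpen {z : ℂ | 0 < z.re} := isOpen_lt continuous_const continuous_re
  have hpre : IsPreconnected {z : ℂ | 0 < z.re} := (convex_halfSpace_re_gt 0).isPreconnected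
  have han1 : AnalyticOnNhd ℂ (LFunction χ) {z : ℂ | 0 < z.re} := fun z _ =>
    (differentiable_LFunction hχ).analyticAt z
  have han2 : AnalyticOnNhd ℂ (fun z => z * mellin g (-z)) {z : ℂ | 0 < z.re} := by
    refine DifferentiableOn.analyticOnNhd (fun z hz => ?_) hdom
    exact (differentiableAt_id.mul
      ((hdiff z hz).comp z differentiableAt_id.neg)).differentiableWithinAt
  have heq := han1.eqOn_of_preconnected_of_eventuallyEq han2 hpre (z₀ := 2) (by simp) (by
    have : {z : ℂ | 1 < z.re} ∈ nhds (2 : ℂ) :=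
      (isOpen_lt continuous_const continuous_re).mem_nhds (by simp)
    filter_upwards [this] with z hz
    rw [LFunction_eq_LSeries χ hz, hint]
    refine LSeries_eq_mul_integral _ le_rfl (zero_lt_one.trans hz)
      (LSeriesSummable_of_one_lt_re χ hz) ?_
    refine Asymptotics.IsBigO.of_bound (2 * N) (Filter.Eventually.of_forall fun t => ?_)
    simpa using norm_sum_Icc_le_s11 hχ t) hs
  rw [heq]
  simp only [hint]
  rfl

lemma norm_LFunction_le_s11 (hχ : χ ≠ 1) {s : ℂ} (hs : 0 < s.re) :
    ‖LFunction χ s‖ ≤ 2 * N * ‖s‖ / s.re := by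
  rw [LFunction_eq_mul_integral hχ hs, norm_mul]
  have h1 : ‖∫ t in Set.Ioi (1 : ℝ), (∑ k ∈ Finset.Icc 1 ⌊t⌋₊, χ (k : ZMod N)) *
      (t : ℂ) ^ (-(s + 1))‖ ≤ ∫ t in Set.Ioi (1 : ℝ), 2 * N * t ^ (-(s.re + 1)) := by
    refine MeasureTheory.norm_integral_le_of_norm_le ?_ ?_
    · exact (integrableOn_Ioi_rpow_of_lt (by linarith) one_pos).const_mul _
    · refine (MeasureTheory.ae_restrict_mem measurableSet_Ioi).mono fun t ht => ?_
      have ht0 : 0 < t := zero_lt_one.trans ht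
      rw [norm_mul, Complex.norm_cpow_eq_rpow_re_of_pos ht0]
      simp only [neg_re, add_re, one_re]
      gcongr
      exact norm_sum_Icc_le_s11 hχ _
  rw [MeasureTheory.integral_const_mul, integral_Ioi_rpow_of_lt (by linarith) one_pos] at h1
  have h2 : -(1 : ℝ) ^ (-(s.re + 1) + 1) / (-(s.re + 1) + 1) = 1 / s.re := by
    rw [Real.one_rpow, neg_add, neg_add_cancel_right, neg_div_neg_eq]
  rw [h2] at h1
  calc _ ≤ ‖s‖ * (2 * N * (1 / s.re)) := by gcongr
    _ = _ := by ring

end DirichletCharacter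

open DirichletCharacter in
lemma exists_LFunction_growth : ∃ B : ℝ, 1 ≤ B ∧ ∀ (N : ℕ) [NeZero N] (χ : DirichletCharacter ℂ N),
    χ ≠ 1 → ∀ t : ℝ, LFunction χ (2 + t * I) ≠ 0 ∧ ∀ z : ℂ, ‖z‖ ≤ 9 / 5 →
      ‖LFunction χ (2 + t * I + z)‖ ≤ B * N * (4 + |t|) * ‖LFunction χ (2 + t * I)‖ := by
  set B₀ : ℝ := ∑' n : ℕ, 1 / (n : ℝ) ^ (2 : ℝ) with hB₀
  have hsum : Summable fun n : ℕ => 1 / (n : ℝ) ^ (2 : ℝ) :=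
    Real.summable_one_div_nat_rpow.mpr (by norm_num)
  have hB1 : 1 ≤ B₀ := by
    have := hsum.le_tsum 1 fun n _ => by positivity
    rwa [Nat.cast_one, Real.one_rpow, div_one] at this
  refine ⟨10 * B₀, by linarith, fun N _ χ hχ t => ?_⟩
  have hs : 1 < (2 + t * I : ℂ).re := by simp
  have hne : LFunction χ (2 + t * I) ≠ 0 :=
    LFunction_ne_zero_of_one_le_re χ (.inl hχ) hs.le
  refine ⟨hne, fun z hz => ?_⟩
  have hlow : 1 ≤ B₀ * ‖LFunction χ (2 + t * I)‖ := by
    have hμ : LSeriesSummable ((fun n : ℕ => χ (n : ZMod N)) *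
        fun n : ℕ => ((ArithmeticFunction.moebius n : ℤ) : ℂ)) (2 + t * I) :=
      LSeriesSummable_mul χ (ArithmeticFunction.LSeriesSummable_moebius_iff.mpr hs)
    have h1 := LSeries_convolution' (LSeriesSummable_of_one_lt_re χ hs) hμ
    rw [convolution_mul_moebius, LSeries_delta, Pi.one_apply, ← LFunction_eq_LSeries χ hs] at h1
    have h2 : ‖LSeries ((fun n : ℕ => χ (n : ZMod N)) *
        fun n : ℕ => ((ArithmeticFunction.moebius n : ℤ) : ℂ)) (2 + t * I)‖ ≤ B₀ := by
      refine tsum_of_norm_bounded hsum.hasSum fun n => ?_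
      rw [LSeries.norm_term_eq]
      split_ifs with hn
      · positivity
      · simp only [Pi.mul_apply, norm_mul]
        have h3 : ‖((ArithmeticFunction.moebius n : ℤ) : ℂ)‖ ≤ 1 := by
          rw [Complex.norm_intCast]
          exact_mod_cast ArithmeticFunction.abs_moebius_le_one
        have h4 : ‖χ (n : ZMod N)‖ * ‖((ArithmeticFunction.moebius n : ℤ) : ℂ)‖ ≤ 1 :=
          mul_le_one₀ (χ.norm_le_one _) (norm_nonneg _) h3
        have h5 : (2 + t * I : ℂ).re = 2 := by simp
        rw [h5]
        gcongr
    have h3 := congrArg norm h1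
    rw [norm_one, norm_mul] at h3
    rw [h3, mul_comm]
    gcongr
  have hre : 1 / 5 ≤ (2 + t * I + z : ℂ).re := by
    have := (abs_le.mp ((abs_re_le_norm z).trans hz)).1
    simp
    linarith
  have hnorm : ‖(2 + t * I + z : ℂ)‖ ≤ 4 + |t| := by
    have h1 := norm_add_le (2 + t * I : ℂ) z
    have h2 := norm_add_le (2 : ℂ) (t * I)
    simp at h2
    linarith
  have hup := norm_LFunction_le_s11 hχ (s := 2 + t * I + z) (by linarith)
  calc _ ≤ 2 * N * ‖(2 + t * I + z : ℂ)‖ / (2 + t * I + z : ℂ).re := hup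
    _ ≤ 2 * N * (4 + |t|) / (1 / 5) := by gcongr
    _ = 10 * N * (4 + |t|) * 1 := by ring
    _ ≤ 10 * N * (4 + |t|) * (B₀ * ‖LFunction χ (2 + t * I)‖) := by gcongr
    _ = _ := by ring

lemma re_add_mul_I (x t : ℝ) : (x + t * I : ℂ).re = x := by simp

lemma im_add_mul_I (x t : ℝ) : (x + t * I : ℂ).im = t := by simp

lemma integrable_vertical_of_norm_le {f : ℝ → ℂ} (hf : Continuous f) {K : ℝ}
    (hK : ∀ t : ℝ, ‖f t‖ ≤ K * (1 + |t|) ^ (-(3 / 2) : ℝ)) : MeasureTheory.Integrable f := by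
  have h : MeasureTheory.Integrable fun t : ℝ => K * (1 + |t|) ^ (-(3 / 2) : ℝ) :=
    (integrable_one_add_norm (E := ℝ) (μ := MeasureTheory.volume) (r := 3 / 2)
      (by norm_num)).const_mul K
  exact h.mono' hf.aestronglyMeasurable (Filter.Eventually.of_forall hK)

lemma continuous_vertical {f : ℂ → ℂ} {σ x : ℝ} (hf : DifferentiableOn ℂ f {s | σ ≤ s.re})
    (hx : σ ≤ x) : Continuous fun t : ℝ => f (x + t * I) := by
  refine hf.continuousOn.comp_continuous (by fun_prop) fun t => ?_
  simpa using hx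

/-- Vertical line integrals of a holomorphic function with uniform decay do not depend
on the line. -/
lemma integral_vertical_eq {f : ℂ → ℂ} {a b K : ℝ} (hab : a ≤ b)
    (hf : DifferentiableOn ℂ f {s | a ≤ s.re})
    (hK : ∀ s : ℂ, a ≤ s.re → s.re ≤ b → ‖f s‖ ≤ K * (1 + |s.im|) ^ (-(3 / 2) : ℝ)) :
    ∫ t : ℝ, f (b + t * I) = ∫ t : ℝ, f (a + t * I) := by
  have hline : ∀ x : ℝ, a ≤ x → x ≤ b →
      MeasureTheory.Integrable fun t : ℝ => f (x + t * I) := fun x hx hxb =>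
    integrable_vertical_of_norm_le (continuous_vertical hf hx) (K := K) fun t => by
      simpa using hK (x + t * I) (by simpa using hx) (by simpa using hxb)
  have hlim : ∀ x : ℝ, a ≤ x → x ≤ b → Filter.Tendsto (fun T : ℝ => ∫ t in (-T)..T, f (x + t * I))
      Filter.atTop (nhds (∫ t : ℝ, f (x + t * I))) := fun x hx hxb =>
    MeasureTheory.intervalIntegral_tendsto_integral (hline x hx hxb) Filter.tendsto_neg_atTop_atBot
      Filter.tendsto_id
  have hdecay : Filter.Tendsto (fun T : ℝ => K * (1 + |T|) ^ (-(3 / 2) : ℝ) * |b - a|) Filter.atTop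
      (nhds 0) := by
    have h1 : Filter.Tendsto (fun T : ℝ => 1 + |T|) Filter.atTop Filter.atTop :=
      Filter.tendsto_atTop_add_const_left _ _ Filter.tendsto_abs_atTop_atTop
    have := (((tendsto_rpow_neg_atTop (y := 3 / 2) (by norm_num)).comp h1).const_mul K).mul_const
      |b - a|
    simpa using this
  have hside : ∀ T : ℝ, ‖∫ x in a..b, f (x + T * I)‖ ≤ K * (1 + |T|) ^ (-(3 / 2) : ℝ) * |b - a| := by
    intro T
    refine intervalIntegral.norm_integral_le_of_norm_le_const fun x hx => ?_
    rw [Set.uIoc_of_le hab] at hx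
    simpa using hK (x + T * I) (by simpa using hx.1.le) (by simpa using hx.2)
  have hz1 : Filter.Tendsto (fun T : ℝ => ∫ x in a..b, f (x + T * I)) Filter.atTop (nhds 0) :=
    squeeze_zero_norm hside hdecay
  have hz2 : Filter.Tendsto (fun T : ℝ => ∫ x in a..b, f (x + (-T : ℝ) * I)) Filter.atTop
      (nhds 0) :=
    squeeze_zero_norm (fun T => by simpa using hside (-T)) hdecay
  have hrect : ∀ T : ℝ, (∫ x in a..b, f (x + (-T : ℝ) * I)) - (∫ x in a..b, f (x + T * I)) +
      I * (∫ t in (-T)..T, f (b + t * I)) - I * (∫ t in (-T)..T, f (a + t * I)) = 0 := by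
    intro T
    have := integral_boundary_rect_eq_zero_of_differentiableOn f (a + (-T : ℝ) * I) (b + T * I)
      (hf.mono fun s hs => by
        have := hs.1
        simp only [re_add_mul_I, Set.mem_preimage, Set.uIcc_of_le hab] at this
        exact this.1)
    simpa only [re_add_mul_I, im_add_mul_I, smul_eq_mul] using this
  have hall := ((hz2.sub hz1).add ((hlim b hab le_rfl).const_mul I)).sub ((hlim a le_rfl hab).const_mul I)
  have h0 := tendsto_nhds_unique (hall.congr hrect) tendsto_const_nhds
  have h1 : I * ((∫ t : ℝ, f (b + t * I)) - ∫ t : ℝ, f (a + t * I)) = 0 := by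
    linear_combination h0
  exact sub_eq_zero.mp ((mul_eq_zero.mp h1).resolve_left I_ne_zero)

/-- A vertical integral vanishes if the line can be pushed to the right and the integrand
decays there. -/
lemma integral_vertical_eq_zero {f : ℂ → ℂ} {a K : ℝ}
    (hf : DifferentiableOn ℂ f {s | a ≤ s.re})
    (hK : ∀ s : ℂ, a ≤ s.re → ‖f s‖ ≤ K * (1 + |s.im|) ^ (-(3 / 2) : ℝ))
    (h0 : ∀ t : ℝ, Filter.Tendsto (fun c : ℝ => f (c + t * I)) Filter.atTop (nhds 0)) :
    ∫ t : ℝ, f (a + t * I) = 0 := by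
  have hbound : MeasureTheory.Integrable fun t : ℝ => K * (1 + |t|) ^ (-(3 / 2) : ℝ) :=
    (integrable_one_add_norm (E := ℝ) (μ := MeasureTheory.volume) (r := 3 / 2)
      (by norm_num)).const_mul K
  have hlim : Filter.Tendsto (fun c : ℝ => ∫ t : ℝ, f (c + t * I)) Filter.atTop
      (nhds (∫ _ : ℝ, (0 : ℂ))) := by
    refine MeasureTheory.tendsto_integral_filter_of_dominated_convergence _ ?_ ?_ hbound
      (Filter.Eventually.of_forall h0)
    · filter_upwards [Filter.eventually_ge_atTop a] with c hc
      exact (continuous_vertical hf hc).aestronglyMeasurable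
    · filter_upwards [Filter.eventually_ge_atTop a] with c hc
      refine Filter.Eventually.of_forall fun t => ?_
      simpa using hK (c + t * I) (by simpa using hc)
  rw [MeasureTheory.integral_zero] at hlim
  refine tendsto_nhds_unique (tendsto_const_nhds.congr' ?_) hlim
  filter_upwards [Filter.eventually_ge_atTop a] with c hc
  exact (integral_vertical_eq hc hf fun s hs _ => hK s hs).symm

/-- Contour shift keeping only the real part of `F`: the conjugate of `F` contributes nothing. -/
lemma norm_integral_mul_le_integral_re {F W : ℂ → ℂ} {σ K C M : ℝ} (hσ2 : σ ≤ 2)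
    (hF : DifferentiableOn ℂ F {s | σ ≤ s.re})
    (hFK : ∀ s : ℂ, σ ≤ s.re → ‖F s‖ ≤ K * (1 + |s.im|) ^ (1 / 2 : ℝ))
    (hFM : ∀ s : ℂ, 2 ≤ s.re → ‖F s‖ ≤ M)
    (hW : Differentiable ℂ W)
    (hWC : ∀ s : ℂ, s.re ≤ 2 → ‖W s‖ ≤ C * (1 + |s.im|) ^ (-2 : ℝ))
    (hWc : ∀ s, W (starRingEnd ℂ s) = starRingEnd ℂ (W s))
    (hW0 : ∀ t : ℝ, Filter.Tendsto (fun c : ℝ => W (c + t * I)) Filter.atBot (nhds 0)) :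
    ‖∫ t : ℝ, F (2 + t * I) * W (2 + t * I)‖ ≤
      2 * ∫ t : ℝ, |(F (σ + t * I)).re| * ‖W (σ + t * I)‖ := by
  have hprod : ∀ {x y : ℂ} {t : ℝ}, ‖x‖ ≤ K * (1 + |t|) ^ (1 / 2 : ℝ) →
      ‖y‖ ≤ C * (1 + |t|) ^ (-2 : ℝ) → ‖x * y‖ ≤ K * C * (1 + |t|) ^ (-(3 / 2) : ℝ) := by
    intro x y t hx hy
    have ht : 0 < 1 + |t| := by positivity
    rw [norm_mul]
    calc _ ≤ (K * (1 + |t|) ^ (1 / 2 : ℝ)) * (C * (1 + |t|) ^ (-2 : ℝ)) :=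
          mul_le_mul hx hy (norm_nonneg _) ((norm_nonneg _).trans hx)
      _ = K * C * ((1 + |t|) ^ (1 / 2 : ℝ) * (1 + |t|) ^ (-2 : ℝ)) := by ring
      _ = _ := by rw [← Real.rpow_add ht]; norm_num
  have hshift := integral_vertical_eq (f := fun s => F s * W s) hσ2
    (hF.mul hW.differentiableOn) fun s h1 h2 => hprod (hFK s h1) (hWC s h2)
  have hrefl : Differentiable ℂ fun s : ℂ => W (2 * σ - s) := by fun_prop
  have hzero := integral_vertical_eq_zero (f := fun s => F s * W (2 * σ - s)) (a := σ)
    (K := K * C) (hF.mul hrefl.differentiableOn)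
    (fun s hs => hprod (hFK s hs) (by
      have := hWC (2 * σ - s) (by simp; linarith)
      simpa using this))
    (fun t => by
      have h1 : Filter.Tendsto (fun c : ℝ => W (2 * σ - (c + t * I))) Filter.atTop (nhds 0) := by
        have h2 : Filter.Tendsto (fun c : ℝ => 2 * σ - c) Filter.atTop Filter.atBot :=
          Filter.tendsto_atBot_add_const_left _ _ Filter.tendsto_neg_atTop_atBot
        refine ((hW0 (-t)).comp h2).congr fun c => ?_
        simp only [Function.comp]
        congr 1
        push_cast
        ring
      have h3 := (h1.norm.const_mul M)
      rw [norm_zero, mul_zero] at h3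
      refine squeeze_zero_norm' ?_ h3
      filter_upwards [Filter.eventually_ge_atTop 2] with c hc
      rw [norm_mul]
      gcongr
      exact hFM _ (by simpa using hc))
  have hconj : ∫ t : ℝ, starRingEnd ℂ (F (σ + t * I)) * W (σ + t * I) = 0 := by
    have h1 : ∀ t : ℝ, starRingEnd ℂ (F (σ + t * I)) * W (σ + t * I) =
        starRingEnd ℂ (F (σ + t * I) * W (2 * σ - (σ + t * I))) := by
      intro t
      rw [map_mul, ← hWc]
      congr 2
      simp only [map_sub, map_add, map_mul, map_ofNat, conj_ofReal, conj_I]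
      ring
    simp_rw [h1]
    rw [integral_conj, hzero, map_zero]
  have hi1 : MeasureTheory.Integrable fun t : ℝ => F (σ + t * I) * W (σ + t * I) :=
    integrable_vertical_of_norm_le
      (continuous_vertical (f := fun s => F s * W s) (hF.mul hW.differentiableOn) le_rfl)
      (K := K * C) fun t => hprod (by simpa using hFK (σ + t * I) (by simp))
        (by simpa using hWC (σ + t * I) (by simpa using hσ2))
  have hi2 : MeasureTheory.Integrable fun t : ℝ =>
      starRingEnd ℂ (F (σ + t * I)) * W (σ + t * I) :=
    integrable_vertical_of_norm_le
      ((continuous_conj.comp (continuous_vertical hF le_rfl)).mul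
        (continuous_vertical (σ := σ) hW.differentiableOn le_rfl))
      (K := K * C) fun t => hprod (by simpa using hFK (σ + t * I) (by simp))
        (by simpa using hWC (σ + t * I) (by simpa using hσ2))
  have hsum : ∫ t : ℝ, F (2 + t * I) * W (2 + t * I) =
      ∫ t : ℝ, 2 * (((F (σ + t * I)).re : ℂ) * W (σ + t * I)) := by
    have h1 : ∀ t : ℝ, 2 * (((F (σ + t * I)).re : ℂ) * W (σ + t * I)) =
        F (σ + t * I) * W (σ + t * I) + starRingEnd ℂ (F (σ + t * I)) * W (σ + t * I) := by
      intro t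
      rw [← add_mul, add_conj]
      push_cast
      ring
    simp_rw [h1]
    rw [MeasureTheory.integral_add hi1 hi2, hconj, add_zero, ← hshift]
    norm_cast
  rw [hsum, MeasureTheory.integral_const_mul, norm_mul]
  simp only [Complex.norm_ofNat]
  gcongr
  refine (MeasureTheory.norm_integral_le_integral_norm _).trans_eq ?_
  simp

lemma hasMellin_log_Ioc {s : ℂ} (hs : 0 < s.re) :
    HasMellin (fun t : ℝ => Real.log t • (Set.Ioc 0 1).indicator (fun _ => (1 : ℂ)) t) s
      (-1 / s ^ 2) := by
  set g : ℝ → ℂ := (Set.Ioc 0 1).indicator fun _ => (1 : ℂ) with hg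
  have hgm : Measurable g := measurable_const.indicator measurableSet_Ioc
  have hgb : ∀ t, ‖g t‖ ≤ 1 := fun t => (norm_indicator_le_norm_self _ _).trans (by simp)
  have key := mellin_hasDerivAt_of_isBigO_rpow (f := g) (s := s) (a := s.re + 1) (b := 0) ?_ ?_
    (by linarith) ?_ hs
  · refine ⟨key.1, key.2.unique ?_⟩
    have h1 : HasDerivAt (fun z : ℂ => 1 / z) (-1 / s ^ 2) s := by
      simpa [neg_div] using hasDerivAt_inv (x := s) (by rintro rfl; simp at hs)
    refine h1.congr_of_eventuallyEq ?_
    filter_upwards [(isOpen_lt continuous_const continuous_re).mem_nhds hs] with z hz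
    exact (hasMellin_one_Ioc hz).2
  · refine MeasureTheory.LocallyIntegrable.locallyIntegrableOn ?_ _
    refine (MeasureTheory.locallyIntegrable_const (1 : ℝ)).mono hgm.aestronglyMeasurable ?_
    exact Filter.Eventually.of_forall fun t => (hgb t).trans (le_abs_self _)
  · refine Asymptotics.IsBigO.of_bound 0 ?_
    filter_upwards [Filter.eventually_gt_atTop 1] with t ht
    have : g t = 0 := Set.indicator_of_notMem (by simp [ht]) _
    simp [this]
  · refine Asymptotics.IsBigO.of_bound 1 (Filter.Eventually.of_forall fun t => ?_)
    simpa using hgb t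

lemma two_add_mul_I_ne_zero (t : ℝ) : (2 + t * I : ℂ) ≠ 0 := by
  intro h
  have := congrArg re h
  simp at this

lemma integrable_inv_two_add_mul_I_sq :
    MeasureTheory.Integrable fun t : ℝ => 1 / (2 + t * I : ℂ) ^ 2 := by
  refine MeasureTheory.Integrable.mono' integrable_inv_one_add_sq ?_
    (Filter.Eventually.of_forall fun t => ?_)
  · refine Continuous.aestronglyMeasurable ?_
    exact continuous_const.div (by fun_prop) fun t => pow_ne_zero 2 (two_add_mul_I_ne_zero t)
  · rw [norm_div, norm_one, norm_pow, ← normSq_eq_norm_sq, one_div]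
    gcongr
    simp [normSq_apply]
    nlinarith

lemma integrable_exp_div_sq (v : ℝ) :
    MeasureTheory.Integrable fun t : ℝ => cexp ((2 + t * I) * v) / (2 + t * I : ℂ) ^ 2 := by
  refine (integrable_inv_two_add_mul_I_sq.norm.const_mul (Real.exp (2 * v))).mono' ?_
    (Filter.Eventually.of_forall fun t => ?_)
  · refine Continuous.aestronglyMeasurable ?_
    exact Continuous.div (by fun_prop) (by fun_prop)
      fun t => pow_ne_zero 2 (two_add_mul_I_ne_zero t)
  · rw [norm_div, norm_div, norm_exp, norm_one]
    simp [div_eq_mul_inv]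

lemma integral_exp_div_sq (v : ℝ) :
    ∫ t : ℝ, cexp ((2 + t * I) * v) / (2 + t * I : ℂ) ^ 2 = 2 * Real.pi * (max v 0 : ℝ) := by
  set h : ℝ → ℂ := fun t => Real.log t • (Set.Ioc 0 1).indicator (fun _ => (1 : ℂ)) t with hh
  have hval : ∀ u : ℝ, 0 < u → h u = ((min (Real.log u) 0 : ℝ) : ℂ) := by
    intro u hu
    by_cases h1 : u ≤ 1
    · have : Real.log u ≤ 0 := Real.log_nonpos hu.le h1
      simp [hh, hu, h1, min_eq_left this]
    · have : 0 ≤ Real.log u := Real.log_nonneg (by linarith)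
      simp only [hh, min_eq_right this]
      rw [Set.indicator_of_notMem (by simp [h1])]
      simp
  have hmel : ∀ t : ℝ, mellin h ((2 : ℝ) + t * I) = -1 / (2 + t * I : ℂ) ^ 2 := fun t => by
    rw [(hasMellin_log_Ioc (s := (2 : ℝ) + t * I) (by simp)).2]
    norm_cast
  have hcont : ContinuousAt h (Real.exp (-v)) := by
    have h1 : ContinuousAt (fun u : ℝ => ((min (Real.log u) 0 : ℝ) : ℂ)) (Real.exp (-v)) := by
      have := Real.continuousAt_log (Real.exp_pos (-v)).ne'
      exact continuous_ofReal.continuousAt.comp (this.min continuousAt_const)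
    refine h1.congr ?_
    filter_upwards [lt_mem_nhds (Real.exp_pos (-v))] with u hu
    exact (hval u hu).symm
  have hinv := mellinInv_mellin_eq 2 h (Real.exp_pos (-v))
    (hasMellin_log_Ioc (s := ((2 : ℝ) : ℂ)) (by simp)).1 (by
      rw [VerticalIntegrable]
      simp_rw [hmel, neg_div]
      exact integrable_inv_two_add_mul_I_sq.neg) hcont
  rw [hval _ (Real.exp_pos _), Real.log_exp, mellinInv] at hinv
  simp_rw [hmel] at hinv
  have hpt : ∀ t : ℝ, ((Real.exp (-v) : ℝ) : ℂ) ^ (-(((2 : ℝ) : ℂ) + t * I)) •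
      (-1 / (2 + t * I : ℂ) ^ 2) = -(cexp ((2 + t * I) * v) / (2 + t * I : ℂ) ^ 2) := by
    intro t
    rw [cpow_def_of_ne_zero (by exact_mod_cast (Real.exp_pos _).ne'), ← ofReal_log
      (Real.exp_pos _).le, Real.log_exp, smul_eq_mul, neg_div, mul_neg, mul_one_div]
    congr 3
    push_cast
    ring
  simp_rw [hpt] at hinv
  rw [MeasureTheory.integral_neg] at hinv
  have hmin : min (-v) 0 = -max v 0 := by
    rw [← neg_zero, min_neg_neg, neg_zero]
  rw [hmin, Complex.real_smul] at hinv
  have hpi : (Real.pi : ℂ) ≠ 0 := by exact_mod_cast Real.pi_ne_zero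
  push_cast at hinv ⊢
  field_simp at hinv
  linear_combination -hinv

/-- The entire function `(exp (a s) - 1) / s`. -/
noncomputable def expSlope (a : ℝ) : ℂ → ℂ := dslope (fun z => cexp (a * z)) 0

lemma expSlope_of_ne (a : ℝ) {s : ℂ} (hs : s ≠ 0) :
    expSlope a s = (cexp (a * s) - 1) / s := by
  rw [expSlope, dslope_of_ne _ hs, slope_def_field]
  simp

lemma expSlope_zero (a : ℝ) : expSlope a 0 = a := by
  rw [expSlope, dslope_same]
  have : HasDerivAt (fun z : ℂ => cexp (a * z)) (cexp (a * 0) * (a * 1)) 0 :=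
    ((hasDerivAt_id (0 : ℂ)).const_mul (a : ℂ)).cexp
  simpa using this.deriv

lemma differentiable_expSlope (a : ℝ) : Differentiable ℂ (expSlope a) := by
  rw [← differentiableOn_univ, expSlope, differentiableOn_dslope Filter.univ_mem]
  exact Differentiable.differentiableOn (by fun_prop)

lemma expSlope_conj (a : ℝ) (s : ℂ) :
    expSlope a (starRingEnd ℂ s) = starRingEnd ℂ (expSlope a s) := by
  by_cases hs : s = 0
  · simp [hs, expSlope_zero]
  · rw [expSlope_of_ne a hs, expSlope_of_ne a (by simpa using hs)]
    simp [← exp_conj]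

lemma norm_expSlope_le {a R : ℝ} (ha : 0 ≤ a) {s : ℂ} (hs : s ≠ 0) (hR : s.re ≤ R) :
    ‖expSlope a s‖ ≤ (Real.exp (a * R) + 1) / ‖s‖ := by
  rw [expSlope_of_ne a hs, norm_div]
  gcongr
  refine (norm_sub_le _ _).trans ?_
  rw [norm_exp, norm_one]
  gcongr
  simpa using mul_le_mul_of_nonneg_left hR ha

lemma exists_norm_expSlope_le {a : ℝ} (ha : 0 ≤ a) (R : ℝ) : ∃ C, 0 ≤ C ∧ ∀ s : ℂ, s.re ≤ R →
    ‖expSlope a s‖ ≤ C * (1 + |s.im|) ^ (-1 : ℝ) := by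
  obtain ⟨M, hM⟩ := (isCompact_closedBall (0 : ℂ) 1).exists_bound_of_continuousOn
    (differentiable_expSlope a).continuous.continuousOn
  have hM0 : 0 ≤ M := (norm_nonneg _).trans (hM 0 (by simp))
  refine ⟨2 * M + 2 * (Real.exp (a * R) + 1), by positivity, fun s hs => ?_⟩
  have hpos : 0 < 1 + |s.im| := by positivity
  rw [Real.rpow_neg_one, ← div_eq_mul_inv, le_div_iff₀ hpos]
  have him := abs_im_le_norm s
  have hE := Real.exp_pos (a * R)
  rcases le_total ‖s‖ 1 with h | h
  · have h1 := hM s (by simpa using h)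
    calc _ ≤ M * 2 := by gcongr; linarith
      _ ≤ _ := by linarith
  · have hs0 : 0 < ‖s‖ := by linarith
    have h1 := norm_expSlope_le ha (norm_pos_iff.mp hs0) hs
    calc _ ≤ (Real.exp (a * R) + 1) / ‖s‖ * (2 * ‖s‖) := by gcongr; linarith
      _ = 2 * (Real.exp (a * R) + 1) := by field_simp
      _ ≤ _ := by linarith

lemma norm_expSlope_div_le {η a : ℝ} (hη : 0 < η) (ha : 0 ≤ a) (ha1 : a ≤ 1) {s : ℂ} (hs : s ≠ 0)
    (hre : η * s.re ≤ 1) : ‖expSlope η s / η‖ ≤ 4 * (η * ‖s‖) ^ (-a) := by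
  have hs0 : 0 < ‖s‖ := norm_pos_iff.mpr hs
  have hz : ‖(η * s : ℂ)‖ = η * ‖s‖ := by simp [abs_of_pos hη]
  have hz0 : 0 < η * ‖s‖ := by positivity
  rw [expSlope_of_ne η hs, div_div, norm_div, mul_comm s, hz, div_le_iff₀ hz0]
  rcases le_total (η * ‖s‖) 1 with h | h
  · have h1 := norm_exp_sub_one_le (x := η * s) (by rwa [hz])
    rw [hz] at h1
    have h2 : 1 ≤ (η * ‖s‖) ^ (-a) := Real.one_le_rpow_of_pos_of_le_one_of_nonpos hz0 h (by linarith)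
    nlinarith
  · have h1 : ‖cexp (η * s) - 1‖ ≤ 4 := by
      refine (norm_sub_le _ _).trans ?_
      rw [norm_exp, norm_one]
      have h3 : Real.exp (η * s : ℂ).re ≤ Real.exp 1 := by
        gcongr
        simpa using hre
      have := Real.exp_one_lt_d9
      linarith
    have h2 : (η * ‖s‖) ^ (-(1 : ℝ)) ≤ (η * ‖s‖) ^ (-a) :=
      Real.rpow_le_rpow_of_exponent_le h (by linarith)
    calc _ ≤ 4 * (η * ‖s‖) ^ (-(1 : ℝ)) * (η * ‖s‖) := by
          rw [Real.rpow_neg_one]; field_simp; exact h1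
      _ ≤ _ := by gcongr

lemma tendsto_expSlope_atBot {a : ℝ} (ha : 0 ≤ a) (t : ℝ) :
    Filter.Tendsto (fun c : ℝ => expSlope a (c + t * I)) Filter.atBot (nhds 0) := by
  have h1 : Filter.Tendsto (fun c : ℝ => 2 / |c|) Filter.atBot (nhds 0) :=
    Filter.Tendsto.const_div_atTop Filter.tendsto_abs_atBot_atTop 2
  refine squeeze_zero_norm' ?_ h1
  filter_upwards [Filter.eventually_lt_atBot 0] with c hc
  have hre : |c| ≤ ‖(c + t * I : ℂ)‖ := by simpa using abs_re_le_norm (c + t * I : ℂ)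
  have hc0 : 0 < |c| := abs_pos.mpr hc.ne
  refine (norm_expSlope_le ha (norm_pos_iff.mp (hc0.trans_le hre))
    (R := 0) (by simpa using hc.le)).trans ?_
  rw [mul_zero, Real.exp_zero, one_add_one_eq_two]
  gcongr

/-- Piecewise linear weight: `1` on `[η, X]`, `0` outside `(0, X + η)`. -/
noncomputable def trapezoid (X η v : ℝ) : ℝ :=
  (max (X + η - v) 0 - max (X - v) 0 - max (η - v) 0 + max (-v) 0) / η

/-- Mellin transform of the trapezoid weight. -/
noncomputable def trapezoidTransform (X η : ℝ) (s : ℂ) : ℂ := expSlope X s * (expSlope η s / η)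

lemma trapezoid_eq_one {X η v : ℝ} (hη : 0 < η) (h1 : η ≤ v) (h2 : v ≤ X) :
    trapezoid X η v = 1 := by
  rw [trapezoid, max_eq_left (by linarith), max_eq_left (by linarith), max_eq_right (by linarith),
    max_eq_right (by linarith)]
  field_simp
  ring

lemma trapezoid_eq_zero {X η v : ℝ} (hη : 0 < η) (hX : 0 ≤ X) (h : X + η ≤ v) :
    trapezoid X η v = 0 := by
  rw [trapezoid, max_eq_right (by linarith), max_eq_right (by linarith), max_eq_right (by linarith),
    max_eq_right (by linarith)]
  simp

lemma abs_trapezoid_le {X η v : ℝ} (hη : 0 < η) (h1 : η ≤ v) : |trapezoid X η v| ≤ 1 := by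
  rw [trapezoid, max_eq_right (a := η - v) (by linarith), max_eq_right (a := -v) (by linarith),
    abs_div, abs_of_pos hη, div_le_one hη, sub_zero, add_zero]
  refine (abs_max_sub_max_le_abs _ _ _).trans ?_
  rw [abs_of_nonneg] <;> linarith

lemma differentiable_trapezoidTransform (X η : ℝ) : Differentiable ℂ (trapezoidTransform X η) :=
  (differentiable_expSlope X).mul ((differentiable_expSlope η).div_const _)

lemma trapezoidTransform_conj (X η : ℝ) (s : ℂ) :
    trapezoidTransform X η (starRingEnd ℂ s) = starRingEnd ℂ (trapezoidTransform X η s) := by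
  simp [trapezoidTransform, expSlope_conj]

lemma exists_norm_trapezoidTransform_le {X η : ℝ} (hX : 0 ≤ X) (hη : 0 < η) (R : ℝ) :
    ∃ C, ∀ s : ℂ, s.re ≤ R → ‖trapezoidTransform X η s‖ ≤ C * (1 + |s.im|) ^ (-2 : ℝ) := by
  obtain ⟨C, hC0, hC⟩ := exists_norm_expSlope_le hX R
  obtain ⟨D, hD0, hD⟩ := exists_norm_expSlope_le hη.le R
  refine ⟨C * D / η, fun s hs => ?_⟩
  have hpos : 0 < 1 + |s.im| := by positivity
  rw [trapezoidTransform, norm_mul, norm_div, norm_real, Real.norm_eq_abs, abs_of_pos hη]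
  calc _ ≤ (C * (1 + |s.im|) ^ (-1 : ℝ)) * (D * (1 + |s.im|) ^ (-1 : ℝ) / η) := by
        gcongr
        exacts [hC s hs, hD s hs]
    _ = C * D / η * ((1 + |s.im|) ^ (-1 : ℝ) * (1 + |s.im|) ^ (-1 : ℝ)) := by ring
    _ = _ := by rw [← Real.rpow_add hpos]; norm_num

lemma tendsto_trapezoidTransform_atBot {X η : ℝ} (hX : 0 ≤ X) (hη : 0 < η) (t : ℝ) :
    Filter.Tendsto (fun c : ℝ => trapezoidTransform X η (c + t * I)) Filter.atBot (nhds 0) := by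
  simpa [trapezoidTransform] using (tendsto_expSlope_atBot hX t).mul
    ((tendsto_expSlope_atBot hη.le t).div_const (η : ℂ))

lemma integrable_trapezoidTransform {X η : ℝ} (hX : 0 ≤ X) (hη : 0 < η) :
    MeasureTheory.Integrable fun t : ℝ => trapezoidTransform X η (2 + t * I) := by
  obtain ⟨C, hC⟩ := exists_norm_trapezoidTransform_le hX hη 2
  refine MeasureTheory.Integrable.mono' ((integrable_one_add_norm (E := ℝ)
    (μ := MeasureTheory.volume) (r := 2) (by norm_num)).const_mul C) ?_
    (Filter.Eventually.of_forall fun t => ?_)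
  · exact ((differentiable_trapezoidTransform X η).continuous.comp
      (by fun_prop)).aestronglyMeasurable
  · simpa using hC (2 + t * I) (by simp)

lemma integral_exp_mul_trapezoidTransform {X η : ℝ} (hη : 0 < η) (v : ℝ) :
    ∫ t : ℝ, cexp (-(2 + t * I) * v) * trapezoidTransform X η (2 + t * I) =
      2 * Real.pi * trapezoid X η v := by
  have hη' : (η : ℂ) ≠ 0 := by exact_mod_cast hη.ne'
  have hpt : ∀ t : ℝ, cexp (-(2 + t * I) * v) * trapezoidTransform X η (2 + t * I) =
      (cexp ((2 + t * I) * (X + η - v : ℝ)) / (2 + t * I : ℂ) ^ 2 -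
        cexp ((2 + t * I) * (X - v : ℝ)) / (2 + t * I : ℂ) ^ 2 -
        cexp ((2 + t * I) * (η - v : ℝ)) / (2 + t * I : ℂ) ^ 2 +
        cexp ((2 + t * I) * (-v : ℝ)) / (2 + t * I : ℂ) ^ 2) / η := by
    intro t
    have hs := two_add_mul_I_ne_zero t
    rw [trapezoidTransform, expSlope_of_ne X hs, expSlope_of_ne η hs]
    set s : ℂ := 2 + t * I
    have e1 : cexp (s * (X + η - v : ℝ)) = cexp (-s * v) * cexp (X * s) * cexp (η * s) := by
      rw [← Complex.exp_add, ← Complex.exp_add]; push_cast; ring_nf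
    have e2 : cexp (s * (X - v : ℝ)) = cexp (-s * v) * cexp (X * s) := by
      rw [← Complex.exp_add]; push_cast; ring_nf
    have e3 : cexp (s * (η - v : ℝ)) = cexp (-s * v) * cexp (η * s) := by
      rw [← Complex.exp_add]; push_cast; ring_nf
    have e4 : cexp (s * (-v : ℝ)) = cexp (-s * v) := by push_cast; ring_nf
    rw [e1, e2, e3, e4]
    field_simp
    ring
  simp_rw [hpt]
  have hE := integrable_exp_div_sq
  have h2 : MeasureTheory.Integrable fun t : ℝ =>
      cexp ((2 + t * I) * (X + η - v : ℝ)) / (2 + t * I : ℂ) ^ 2 -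
        cexp ((2 + t * I) * (X - v : ℝ)) / (2 + t * I : ℂ) ^ 2 := (hE _).sub (hE _)
  have h3 : MeasureTheory.Integrable fun t : ℝ =>
      cexp ((2 + t * I) * (X + η - v : ℝ)) / (2 + t * I : ℂ) ^ 2 -
        cexp ((2 + t * I) * (X - v : ℝ)) / (2 + t * I : ℂ) ^ 2 -
        cexp ((2 + t * I) * (η - v : ℝ)) / (2 + t * I : ℂ) ^ 2 := h2.sub (hE _)
  rw [MeasureTheory.integral_div, MeasureTheory.integral_add h3 (hE (-v)),
    MeasureTheory.integral_sub h2 (hE (η - v)), MeasureTheory.integral_sub (hE _) (hE _)]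
  simp only [integral_exp_div_sq]
  rw [trapezoid]
  push_cast
  ring

lemma integral_LSeries_mul_trapezoidTransform {f : ℕ → ℂ} (hf : LSeriesSummable f 2)
    {X η : ℝ} (hX : 0 ≤ X) (hη : 0 < η) (h0 : f 0 = 0) :
    ∫ t : ℝ, LSeries f (2 + t * I) * trapezoidTransform X η (2 + t * I) =
      2 * Real.pi * ∑' n : ℕ, f n * trapezoid X η (Real.log n) := by
  have hW := integrable_trapezoidTransform hX hη
  have hterm : ∀ (n : ℕ) (t : ℝ), LSeries.term f (2 + t * I) n =
      f n * cexp (-(2 + t * I) * Real.log n) := by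
    intro n t
    rcases eq_or_ne n 0 with rfl | hn
    · simp [h0]
    · rw [LSeries.term_of_ne_zero hn, cpow_def_of_ne_zero (by exact_mod_cast hn), div_eq_mul_inv,
        ← Complex.exp_neg, natCast_log]
      congr 2
      ring
  have hnorm : ∀ (n : ℕ) (t : ℝ), ‖LSeries.term f (2 + t * I) n‖ = ‖LSeries.term f 2 n‖ := by
    intro n t
    rw [LSeries.norm_term_eq, LSeries.norm_term_eq]
    simp
  have hint : ∀ n : ℕ, MeasureTheory.Integrable fun t : ℝ =>
      LSeries.term f (2 + t * I) n * trapezoidTransform X η (2 + t * I) := by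
    intro n
    refine hW.bdd_mul (c := ‖LSeries.term f 2 n‖) ?_
      (Filter.Eventually.of_forall fun t => (hnorm n t).le)
    simp_rw [hterm]
    exact Continuous.aestronglyMeasurable (by fun_prop)
  have hsum := MeasureTheory.hasSum_integral_of_summable_integral_norm hint (by
    simp_rw [norm_mul, hnorm, MeasureTheory.integral_const_mul]
    exact hf.norm.mul_right _)
  have heq : ∀ t : ℝ, ∑' n, LSeries.term f (2 + t * I) n * trapezoidTransform X η (2 + t * I) =
      LSeries f (2 + t * I) * trapezoidTransform X η (2 + t * I) := fun t => by
    rw [tsum_mul_right, LSeries]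
  simp_rw [heq] at hsum
  rw [← hsum.tsum_eq, ← tsum_mul_left]
  congr 1 with n
  simp_rw [hterm, mul_assoc]
  rw [MeasureTheory.integral_const_mul, integral_exp_mul_trapezoidTransform hη]
  ring

lemma sum_range_rpow_le {b : ℝ} (hb : 0 < b) (N : ℕ) :
    ∑ m ∈ Finset.range N, ((m : ℝ) + 1) ^ (-1 - b) ≤ 1 + 1 / b := by
  have hstep : ∀ n : ℕ, 1 ≤ n → b * ((n : ℝ) + 1) ^ (-1 - b) ≤
      (n : ℝ) ^ (-b) - ((n : ℝ) + 1) ^ (-b) := by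
    intro n hn
    have hn0 : (0 : ℝ) < n := by exact_mod_cast hn
    have hn1 : (0 : ℝ) < (n : ℝ) + 1 := by positivity
    have h1 : 1 + b / ((n : ℝ) + 1) ≤ ((n : ℝ) / (n + 1)) ^ (-b) := by
      rw [Real.rpow_def_of_pos (by positivity)]
      have h2 := Real.add_one_le_exp (Real.log ((n : ℝ) / (n + 1)) * -b)
      have h3 := Real.log_le_sub_one_of_pos (x := (n : ℝ) / (n + 1)) (by positivity)
      have h4 : (n : ℝ) / (n + 1) - 1 = -(1 / (n + 1)) := by field_simp; ring
      have h5 : b / ((n : ℝ) + 1) = b * (1 / (n + 1)) := by ring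
      nlinarith
    rw [Real.div_rpow hn0.le hn1.le, le_div_iff₀ (by positivity)] at h1
    have h2 : ((n : ℝ) + 1) ^ (-1 - b) = ((n : ℝ) + 1) ^ (-b) / (n + 1) := by
      rw [sub_eq_neg_add, ← sub_eq_add_neg, Real.rpow_sub_one hn1.ne']
    rw [h2]
    calc _ = (1 + b / ((n : ℝ) + 1)) * ((n : ℝ) + 1) ^ (-b) - ((n : ℝ) + 1) ^ (-b) := by ring
      _ ≤ _ := by linarith
  have hind : ∀ n : ℕ, ∑ m ∈ Finset.range (n + 1), ((m : ℝ) + 1) ^ (-1 - b) ≤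
      1 + 1 / b - 1 / b * ((n : ℝ) + 1) ^ (-b) := by
    intro n
    induction n with
    | zero => simp
    | succ n ih =>
      rw [Finset.sum_range_succ]
      have h1 := hstep (n + 1) (by simp)
      push_cast at h1 ⊢
      have h2 : ((n : ℝ) + 1 + 1) ^ (-1 - b) ≤
          1 / b * (((n : ℝ) + 1) ^ (-b) - ((n : ℝ) + 1 + 1) ^ (-b)) := by
        rw [one_div, inv_mul_eq_div, le_div_iff₀ hb]
        linarith
      linarith
  cases N with
  | zero => simp; positivity
  | succ n =>
    refine (hind n).trans ?_
    have : 0 ≤ 1 / b * ((n : ℝ) + 1) ^ (-b) := by positivity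
    linarith

lemma integral_le_of_unit_intervals {h : ℝ → ℝ} (hi : MeasureTheory.Integrable h) {c : ℕ → ℝ}
    {S : ℝ} (h1 : ∀ m : ℕ, ∫ t in (m : ℝ)..(m + 1), h t ≤ c m)
    (h2 : ∀ m : ℕ, ∫ t in (-(m + 1) : ℝ)..(-m), h t ≤ c m)
    (hS : ∀ N : ℕ, ∑ m ∈ Finset.range N, c m ≤ S) : ∫ t, h t ≤ 2 * S := by
  have hii : ∀ a b : ℝ, IntervalIntegrable h MeasureTheory.volume a b := fun a b =>
    hi.intervalIntegrable
  have hN : ∀ N : ℕ, ∫ t in (-N : ℝ)..N, h t ≤ 2 * ∑ m ∈ Finset.range N, c m := by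
    intro N
    induction N with
    | zero => simp
    | succ N ih =>
      rw [Finset.sum_range_succ]
      have h3 := intervalIntegral.integral_add_adjacent_intervals (hii (-(N + 1)) (-N)) (hii (-N) N)
      have h4 := intervalIntegral.integral_add_adjacent_intervals (hii (-(N + 1)) N)
        (hii N (N + 1))
      have := h1 N
      have := h2 N
      push_cast
      linarith
  have hlim := MeasureTheory.intervalIntegral_tendsto_integral hi
    (Filter.tendsto_neg_atTop_atBot.comp (tendsto_natCast_atTop_atTop (R := ℝ)))
    (tendsto_natCast_atTop_atTop (R := ℝ))
  refine le_of_tendsto' hlim fun N => (hN N).trans ?_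
  have := hS N
  linarith

lemma norm_rpow_le_of_le {σ a t : ℝ} {m : ℕ} (hσ : 1 / 2 ≤ σ) (ha : 0 < a) (ha1 : a ≤ 1)
    (ht : (m : ℝ) ≤ |t|) :
    ‖(σ + t * I : ℂ)‖ ^ (-1 - a) ≤ 16 * ((m : ℝ) + 1) ^ (-1 - a) := by
  have h1 := abs_re_le_norm (σ + t * I : ℂ)
  have h2 := abs_im_le_norm (σ + t * I : ℂ)
  rw [show (σ + t * I : ℂ).re = σ by simp, abs_of_pos (by linarith)] at h1
  rw [show (σ + t * I : ℂ).im = t by simp] at h2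
  have h3 : ((m : ℝ) + 1) / 4 ≤ ‖(σ + t * I : ℂ)‖ := by linarith
  calc _ ≤ (((m : ℝ) + 1) / 4) ^ (-1 - a) :=
        Real.rpow_le_rpow_of_nonpos (by positivity) h3 (by linarith)
    _ = ((m : ℝ) + 1) ^ (-1 - a) * 4 ^ (1 + a) := by
        rw [Real.div_rpow (by positivity) (by norm_num), div_eq_mul_inv, ← Real.rpow_neg
          (by norm_num)]
        congr 2
        ring
    _ ≤ ((m : ℝ) + 1) ^ (-1 - a) * 4 ^ (2 : ℝ) := by
        gcongr
        · norm_num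
        · linarith
    _ = _ := by norm_num; ring

lemma log_mul_le_rpow {P a y : ℝ} {m : ℕ} (hP : 1 ≤ P) (ha : 0 < a) (hy : |y| ≤ m + 1) :
    Real.log (P * (4 + |y|)) ≤ (Real.log (5 * P) + 2 / a) * ((m : ℝ) + 1) ^ (a / 2) := by
  have hm : (0 : ℝ) < (m : ℝ) + 1 := by positivity
  have hm1 : 1 ≤ ((m : ℝ) + 1) ^ (a / 2) := Real.one_le_rpow (by simp) (by positivity)
  have h1 : Real.log (P * (4 + |y|)) ≤ Real.log (5 * P * (m + 1)) := by
    apply Real.log_le_log (by positivity)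
    have : 4 + |y| ≤ 5 * ((m : ℝ) + 1) := by linarith
    nlinarith
  rw [Real.log_mul (x := 5 * P) (by positivity) (by positivity)] at h1
  have h2 := Real.log_le_rpow_div hm.le (ε := a / 2) (by positivity)
  have h3 : 0 ≤ Real.log (5 * P) := Real.log_nonneg (by linarith)
  have h4 : ((m : ℝ) + 1) ^ (a / 2) / (a / 2) = 2 / a * ((m : ℝ) + 1) ^ (a / 2) := by field_simp
  nlinarith

lemma integral_mul_le_of_unit_intervals {g V : ℝ → ℝ} {σ a G D P : ℝ} (hσ : 1 / 2 ≤ σ)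
    (ha : 0 < a) (ha1 : a ≤ 1) (hG : 0 ≤ G) (hD : 0 ≤ D) (hP : 1 ≤ P) (hg : Continuous g)
    (hg0 : ∀ t, 0 ≤ g t) (hi : MeasureTheory.Integrable fun t => g t * V t)
    (hgI : ∀ k : ℝ, ∫ t in k..(k + 1), g t ≤ G * Real.log (P * (4 + |k + 1 / 2|)))
    (hV : ∀ t : ℝ, V t ≤ D * ‖(σ + t * I : ℂ)‖ ^ (-1 - a)) :
    ∫ t, g t * V t ≤ 2 * (16 * G * D * (Real.log (5 * P) + 2 / a) * (1 + 2 / a)) := by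
  set E := 16 * G * D * (Real.log (5 * P) + 2 / a) with hE
  have hlog : 0 ≤ Real.log (5 * P) := Real.log_nonneg (by linarith)
  have hE0 : 0 ≤ E := by positivity
  have hpiece : ∀ (m : ℕ) (k : ℝ), |k + 1 / 2| ≤ m + 1 →
      (∀ t ∈ Set.Icc k (k + 1), (m : ℝ) ≤ |t|) →
      ∫ t in k..(k + 1), g t * V t ≤ E * ((m : ℝ) + 1) ^ (-1 - a / 2) := by
    intro m k hk hmt
    have hm : (0 : ℝ) < (m : ℝ) + 1 := by positivity
    calc ∫ t in k..(k + 1), g t * V t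
        ≤ ∫ t in k..(k + 1), g t * (D * (16 * ((m : ℝ) + 1) ^ (-1 - a))) := by
          refine intervalIntegral.integral_mono_on (by linarith) hi.intervalIntegrable
            ((hg.mul continuous_const).intervalIntegrable _ _) fun t ht => ?_
          refine mul_le_mul_of_nonneg_left ((hV t).trans ?_) (hg0 t)
          exact mul_le_mul_of_nonneg_left (norm_rpow_le_of_le hσ ha ha1 (hmt t ht)) hD
      _ = (∫ t in k..(k + 1), g t) * (D * (16 * ((m : ℝ) + 1) ^ (-1 - a))) :=
          intervalIntegral.integral_mul_const _ _
      _ ≤ (G * ((Real.log (5 * P) + 2 / a) * ((m : ℝ) + 1) ^ (a / 2))) *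
            (D * (16 * ((m : ℝ) + 1) ^ (-1 - a))) := by
          gcongr
          refine (hgI k).trans ?_
          gcongr
          exact log_mul_le_rpow hP ha hk
      _ = E * (((m : ℝ) + 1) ^ (a / 2) * ((m : ℝ) + 1) ^ (-1 - a)) := by rw [hE]; ring
      _ = _ := by rw [← Real.rpow_add hm]; ring_nf
  refine integral_le_of_unit_intervals hi (c := fun m => E * ((m : ℝ) + 1) ^ (-1 - a / 2))
    (fun m => hpiece m m ?_ ?_) (fun m => ?_) fun N => ?_
  · rw [abs_of_pos (by positivity)]
    linarith
  · intro t ht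
    exact ht.1.trans (le_abs_self t)
  · have := hpiece m (-(m + 1)) ?_ ?_
    · convert this using 2
      ring
    · rw [abs_of_nonpos] <;> linarith [(Nat.cast_nonneg m : (0 : ℝ) ≤ m)]
    · intro t ht
      have := ht.2
      have := neg_abs_le t
      have := neg_le_abs t
      linarith
  · rw [← Finset.mul_sum]
    gcongr
    refine (sum_range_rpow_le (by positivity) N).trans_eq ?_
    field_simp

/-- Replacing the sharp cutoff `n ≤ x` by a trapezoid weight costs `O(√x log x)`. -/
lemma norm_sum_le_norm_tsum_trapezoid_add {f : ℕ → ℂ}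
    (hf : ∀ n, ‖f n‖ ≤ ArithmeticFunction.vonMangoldt n) {x : ℝ} (hx : 2 ≤ x) :
    ‖∑ n ∈ Finset.Iic ⌊x⌋₊, f n‖ ≤
      ‖∑' n : ℕ, f n * trapezoid (Real.log x) (1 / (2 * √x)) (Real.log n)‖ +
        (√x + 1) * (Real.log x + 1) := by
  set X := Real.log x with hX
  set η := 1 / (2 * √x) with hη
  have hx0 : 0 < x := by linarith
  have hs1 : 1 ≤ √x := Real.one_le_sqrt.mpr (by linarith)
  have hss : √x * √x = x := Real.mul_self_sqrt hx0.le
  have hη0 : 0 < η := by positivity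
  have hη2 : η ≤ 1 / 2 := by
    rw [hη]
    exact one_div_le_one_div_of_le (by norm_num) (by linarith)
  have hX0 : 0 ≤ X := Real.log_nonneg (by linarith)
  have hexp : x * Real.exp η ≤ x + √x := by
    have h1 := Real.exp_bound_div_one_sub_of_interval hη0.le (by linarith)
    have h2 : 1 / (1 - η) ≤ 1 + 2 * η := by
      rw [div_le_iff₀ (by linarith)]
      nlinarith
    have h3 : x * (2 * η) = √x := by
      rw [hη]
      field_simp
      nlinarith
    nlinarith
  have hxe : x ≤ x * Real.exp η := le_mul_of_one_le_right hx0.le (Real.one_le_exp hη0.le)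
  set N := ⌊x * Real.exp η⌋₊ with hN
  have hMN : ⌊x⌋₊ + 1 ≤ N + 1 := Nat.succ_le_succ (Nat.floor_mono hxe)
  have hzero : ∀ n : ℕ, n ≤ 1 → f n = 0 := by
    intro n hn
    have h1 := hf n
    interval_cases n <;> simpa using h1
  have hlogn : ∀ n : ℕ, 2 ≤ n → η ≤ Real.log n := fun n hn => by
    have h1 : Real.log 2 ≤ Real.log n := Real.log_le_log (by norm_num) (by exact_mod_cast hn)
    have := Real.log_two_gt_d9
    linarith
  have htsum : ∑' n : ℕ, f n * trapezoid X η (Real.log n) =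
      ∑ n ∈ Finset.range (N + 1), f n * trapezoid X η (Real.log n) := by
    refine tsum_eq_sum fun n hn => ?_
    have hn1 : N < n := by simpa [Nat.lt_succ_iff] using hn
    have hn2 : x * Real.exp η < n := (Nat.floor_lt (by positivity)).mp hn1
    have hn3 : X + η ≤ Real.log n := by
      rw [hX, ← Real.log_exp η, ← Real.log_mul hx0.ne' (Real.exp_pos η).ne']
      exact Real.log_le_log (by positivity) hn2.le
    rw [trapezoid_eq_zero hη0 hX0 hn3]
    simp
  have hmain : ∑ n ∈ Finset.range (⌊x⌋₊ + 1), f n * trapezoid X η (Real.log n) =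
      ∑ n ∈ Finset.Iic ⌊x⌋₊, f n := by
    rw [← Nat.range_succ_eq_Iic]
    refine Finset.sum_congr rfl fun n hn => ?_
    rcases le_or_gt n 1 with h | h
    · simp [hzero n h]
    · have h1 : (n : ℝ) ≤ x :=
        (Nat.le_floor_iff hx0.le).mp (Nat.lt_succ_iff.mp (Finset.mem_range.mp hn))
      rw [trapezoid_eq_one hη0 (hlogn n h)
        (Real.log_le_log (by exact_mod_cast (by omega : 0 < n)) h1)]
      simp
  have htail : ‖∑ n ∈ Finset.Ico (⌊x⌋₊ + 1) (N + 1), f n * trapezoid X η (Real.log n)‖ ≤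
      (√x + 1) * (X + 1) := by
    have hx2 : 2 ≤ ⌊x⌋₊ := Nat.le_floor (by exact_mod_cast hx)
    refine (norm_sum_le_of_le _ (n := fun _ => X + 1) fun n hn => ?_).trans ?_
    · have hn := Finset.mem_Ico.mp hn
      have hn0 : (0 : ℝ) < n := by exact_mod_cast (by omega : 0 < n)
      have h1 : (n : ℝ) ≤ x * Real.exp η :=
        (Nat.le_floor_iff (by positivity)).mp (Nat.lt_succ_iff.mp hn.2)
      have h2 : Real.log n ≤ X + η := by
        refine (Real.log_le_log hn0 h1).trans_eq ?_
        rw [Real.log_mul hx0.ne' (Real.exp_pos η).ne', Real.log_exp]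
      have h3 := abs_trapezoid_le (X := X) hη0 (hlogn n (by omega))
      rw [norm_mul, norm_real, Real.norm_eq_abs]
      calc _ ≤ ‖f n‖ * 1 := by gcongr
        _ ≤ Real.log n := by
          rw [mul_one]
          exact (hf n).trans ArithmeticFunction.vonMangoldt_le_log
        _ ≤ _ := by linarith
    · rw [Finset.sum_const, Nat.card_Ico, nsmul_eq_mul, Nat.cast_sub hMN]
      have h1 : (N : ℝ) ≤ x * Real.exp η := Nat.floor_le (by positivity)
      have h2 := Nat.lt_floor_add_one x
      push_cast
      gcongr
      linarith
  rw [htsum, ← Finset.sum_range_add_sum_Ico _ hMN, hmain]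
  have h1 := norm_sub_le ((∑ n ∈ Finset.Iic ⌊x⌋₊, f n) +
    ∑ n ∈ Finset.Ico (⌊x⌋₊ + 1) (N + 1), f n * trapezoid X η (Real.log n))
    (∑ n ∈ Finset.Ico (⌊x⌋₊ + 1) (N + 1), f n * trapezoid X η (Real.log n))
  rw [add_sub_cancel_right] at h1
  linarith

lemma norm_trapezoidTransform_le {X η σ a : ℝ} (hX : 0 ≤ X) (hη : 0 < η) (hσ : 0 < σ)
    (hησ : η * σ ≤ 1) (ha : 0 ≤ a) (ha1 : a ≤ 1) (t : ℝ) :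
    ‖trapezoidTransform X η (σ + t * I)‖ ≤
      8 * Real.exp (X * σ) * η ^ (-a) * ‖(σ + t * I : ℂ)‖ ^ (-1 - a) := by
  have hs : (σ + t * I : ℂ) ≠ 0 := fun h => by
    have := congrArg re h
    simp at this
    exact hσ.ne' this
  have hs0 : 0 < ‖(σ + t * I : ℂ)‖ := norm_pos_iff.mpr hs
  have h1 := norm_expSlope_le hX hs (R := σ) (by simp)
  have h2 := norm_expSlope_div_le hη ha ha1 hs (by simpa using hησ)
  have h3 : 1 ≤ Real.exp (X * σ) := Real.one_le_exp (by positivity)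
  rw [trapezoidTransform, norm_mul]
  calc _ ≤ ((Real.exp (X * σ) + 1) / ‖(σ + t * I : ℂ)‖) *
        (4 * (η * ‖(σ + t * I : ℂ)‖) ^ (-a)) := by gcongr
    _ ≤ ((2 * Real.exp (X * σ)) / ‖(σ + t * I : ℂ)‖) *
        (4 * (η * ‖(σ + t * I : ℂ)‖) ^ (-a)) := by gcongr; linarith
    _ = _ := by
      rw [Real.mul_rpow hη.le hs0.le, sub_eq_neg_add, ← sub_eq_add_neg, Real.rpow_sub_one hs0.ne']
      ring

lemma norm_logDeriv_le_rpow {L : ℂ → ℂ} {P θ σ M : ℝ} (hL : Differentiable ℂ L) (hP : 1 ≤ P)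
    (h2 : ∀ t : ℝ, L (2 + t * I) ≠ 0)
    (hle : ∀ (t : ℝ) z, ‖z‖ ≤ 9 / 5 →
      ‖L (2 + t * I + z)‖ ≤ Real.exp (Real.log (P * (4 + |t|))) * ‖L (2 + t * I)‖)
    (hA : ∀ t : ℝ, 1 ≤ Real.log (P * (4 + |t|)))
    (hzero : ∀ s : ℂ, 1 / 5 < s.re → L s = 0 → s.re ≤ θ) (hθ : 1 / 2 ≤ θ) (hσ : θ < σ)
    (hM0 : 0 ≤ M) (hM : ∀ s : ℂ, 2 ≤ s.re → ‖logDeriv L s‖ ≤ M) (s : ℂ) (hs : σ ≤ s.re) :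
    ‖logDeriv L s‖ ≤ (M + (2000 + 19 / (σ - θ)) * (2 * (4 * P) ^ (1 / 2 : ℝ))) *
      (1 + |s.im|) ^ (1 / 2 : ℝ) := by
  have hσθ : 0 < σ - θ := sub_pos.mpr hσ
  have h1 : 1 ≤ (1 + |s.im|) ^ (1 / 2 : ℝ) := Real.one_le_rpow (by simp) (by norm_num)
  rcases le_total 2 s.re with h | h
  · calc _ ≤ M * 1 := by rw [mul_one]; exact hM s h
      _ ≤ M * (1 + |s.im|) ^ (1 / 2 : ℝ) := by gcongr
      _ ≤ _ := by
        gcongr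
        exact le_add_of_nonneg_right (by positivity)
  · have h3 := norm_logDeriv_le_strip (A := fun t => Real.log (P * (4 + |t|))) hL hA h2 hle hzero
      hθ (hσ.trans_le hs) h s.im
    rw [re_add_im] at h3
    have h4 : Real.log (P * (4 + |s.im|)) ≤
        2 * (4 * P) ^ (1 / 2 : ℝ) * (1 + |s.im|) ^ (1 / 2 : ℝ) := by
      have h5 := Real.log_le_rpow_div (x := P * (4 + |s.im|)) (by positivity)
        (ε := 1 / 2) (by norm_num)
      have h6 : (P * (4 + |s.im|)) ^ (1 / 2 : ℝ) ≤ (4 * P * (1 + |s.im|)) ^ (1 / 2 : ℝ) := by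
        apply Real.rpow_le_rpow (by positivity) _ (by norm_num)
        nlinarith [abs_nonneg s.im]
      rw [Real.mul_rpow (x := 4 * P) (by positivity) (by positivity)] at h6
      linarith
    calc _ ≤ _ := h3
      _ ≤ (2000 + 19 / (σ - θ)) *
          (2 * (4 * P) ^ (1 / 2 : ℝ) * (1 + |s.im|) ^ (1 / 2 : ℝ)) := by
        gcongr
        linarith [hA s.im]
      _ ≤ _ := by
        have : 0 ≤ M * (1 + |s.im|) ^ (1 / 2 : ℝ) := by positivity
        linarith

namespace DirichletCharacter

lemma LSeriesSummable_vonMangoldt_mul {N : ℕ} {χ : DirichletCharacter ℂ N} {s : ℂ} (hs : 1 < s.re) :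
    LSeriesSummable (fun n => (ArithmeticFunction.vonMangoldt n : ℂ) * χ (n : ZMod N)) s := by
  have h := LSeriesSummable_twist_vonMangoldt χ hs
  convert h using 1
  ext n
  exact mul_comm _ _

variable {N : ℕ} [NeZero N] {χ : DirichletCharacter ℂ N}

lemma LSeries_vonMangoldt_mul_eq {s : ℂ} (hs : 1 < s.re) :
    LSeries (fun n => (ArithmeticFunction.vonMangoldt n : ℂ) * χ (n : ZMod N)) s =
      -logDeriv (LFunction χ) s := by
  have h := LSeries_twist_vonMangoldt_eq χ hs
  rw [logDeriv_apply, deriv_LFunction_eq_deriv_LSeries χ hs, LFunction_eq_LSeries χ hs, ← neg_div,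
    ← h]
  congr 1
  ext n
  exact mul_comm _ _

lemma exists_norm_logDeriv_LFunction_le : ∃ M, 0 ≤ M ∧ ∀ s : ℂ, 2 ≤ s.re →
    ‖logDeriv (LFunction χ) s‖ ≤ M := by
  set f : ℕ → ℂ := fun n => (ArithmeticFunction.vonMangoldt n : ℂ) * χ (n : ZMod N)
  have hsum : LSeriesSummable f 2 := LSeriesSummable_vonMangoldt_mul (by simp)
  refine ⟨∑' n, ‖LSeries.term f 2 n‖, tsum_nonneg fun n => norm_nonneg _, fun s hs => ?_⟩
  rw [← norm_neg, ← LSeries_vonMangoldt_mul_eq (by linarith)]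
  refine tsum_of_norm_bounded hsum.norm.hasSum fun n => ?_
  exact LSeries.norm_term_le_of_re_le_re f (by simpa using hs) n

/-- Smoothed explicit bound for `∑ Λ(n) χ(n)` with a trapezoid weight. -/
lemma norm_tsum_trapezoid_le {P θ σ a X η : ℝ} (hχ : χ ≠ 1) (hP : 1 ≤ P)
    (hgrowth : ∀ t : ℝ, LFunction χ (2 + t * I) ≠ 0 ∧ ∀ z : ℂ, ‖z‖ ≤ 9 / 5 →
      ‖LFunction χ (2 + t * I + z)‖ ≤ P * (4 + |t|) * ‖LFunction χ (2 + t * I)‖)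
    (hzero : ∀ s : ℂ, 1 / 5 < s.re → LFunction χ s = 0 → s.re ≤ θ) (hθ : 1 / 2 ≤ θ)
    (hσ : θ < σ) (hσ2 : σ ≤ 2) (hX : 0 ≤ X) (hη : 0 < η) (hησ : η * σ ≤ 1) (ha : 0 < a)
    (ha1 : a ≤ 1) :
    ‖∑' n : ℕ, (ArithmeticFunction.vonMangoldt n : ℂ) * χ (n : ZMod N) *
        trapezoid X η (Real.log n)‖ ≤
      4 * (16 * 2100 * (8 * Real.exp (X * σ) * η ^ (-a)) *
        (Real.log (5 * P) + 2 / a) * (1 + 2 / a)) := by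
  set f : ℕ → ℂ := fun n => (ArithmeticFunction.vonMangoldt n : ℂ) * χ (n : ZMod N) with hf
  set F : ℂ → ℂ := fun s => -logDeriv (LFunction χ) s with hF
  set W := trapezoidTransform X η with hW
  have hL := differentiable_LFunction hχ
  have hA : ∀ t : ℝ, 1 ≤ Real.log (P * (4 + |t|)) := fun t => by
    rw [Real.le_log_iff_exp_le (by positivity)]
    have := Real.exp_one_lt_d9
    nlinarith [abs_nonneg t]
  have hle : ∀ (t : ℝ) z, ‖z‖ ≤ 9 / 5 → ‖LFunction χ (2 + t * I + z)‖ ≤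
      Real.exp (Real.log (P * (4 + |t|))) * ‖LFunction χ (2 + t * I)‖ := fun t z hz => by
    rw [Real.exp_log (by positivity)]
    exact (hgrowth t).2 z hz
  have h2 := fun t => (hgrowth t).1
  have hne : ∀ s : ℂ, σ ≤ s.re → LFunction χ s ≠ 0 := fun s hs h => by
    have := hzero s (by linarith) h
    linarith
  have hdiff : DifferentiableOn ℂ F {s | σ ≤ s.re} := by
    have h1 : Differentiable ℂ (deriv (LFunction χ)) := by
      rw [← differentiableOn_univ]
      exact hL.differentiableOn.deriv isOpen_univ
    exact (h1.differentiableOn.div hL.differentiableOn hne).neg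
  obtain ⟨M, hM0, hM⟩ := exists_norm_logDeriv_LFunction_le (χ := χ)
  have hFK := norm_logDeriv_le_rpow hL hP h2 hle hA hzero hθ hσ hM0 hM
  set K := M + (2000 + 19 / (σ - θ)) * (2 * (4 * P) ^ (1 / 2 : ℝ))
  obtain ⟨C, hC⟩ := exists_norm_trapezoidTransform_le hX hη 2
  have hFK' : ∀ s : ℂ, σ ≤ s.re → ‖F s‖ ≤ K * (1 + |s.im|) ^ (1 / 2 : ℝ) := fun s hs => by
    rw [hF, norm_neg]
    exact hFK s hs
  have hshift := norm_integral_mul_le_integral_re (F := F) (W := W) (M := M) hσ2 hdiff hFK'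
    (fun s hs => by rw [hF, norm_neg]; exact hM s hs)
    (differentiable_trapezoidTransform X η) hC (trapezoidTransform_conj X η)
    (tendsto_trapezoidTransform_atBot hX hη)
  have hsum := integral_LSeries_mul_trapezoidTransform (f := f)
    (LSeriesSummable_vonMangoldt_mul (by simp)) hX hη (by simp [hf])
  have hLs : ∀ t : ℝ, LSeries f (2 + t * I) = F (2 + t * I) := fun t =>
    LSeries_vonMangoldt_mul_eq (by simp)
  simp_rw [hLs] at hsum
  rw [hsum, norm_mul] at hshift
  have hFcont : Continuous fun t : ℝ => F (σ + t * I) := continuous_vertical hdiff le_rfl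
  have hWcont : Continuous fun t : ℝ => W (σ + t * I) :=
    (differentiable_trapezoidTransform X η).continuous.comp (by fun_prop)
  have hint : MeasureTheory.Integrable fun t : ℝ => |(F (σ + t * I)).re| * ‖W (σ + t * I)‖ := by
    have h3 : MeasureTheory.Integrable fun t : ℝ => F (σ + t * I) * W (σ + t * I) := by
      refine integrable_vertical_of_norm_le (hFcont.mul hWcont) (K := K * C) fun t => ?_
      have h4 := hFK' (σ + t * I) (by simp)
      have h5 := hC (σ + t * I) (by simpa using hσ2)
      rw [im_add_mul_I] at h4 h5
      have ht : 0 < 1 + |t| := by positivity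
      rw [norm_mul]
      calc _ ≤ (K * (1 + |t|) ^ (1 / 2 : ℝ)) * (C * (1 + |t|) ^ (-2 : ℝ)) :=
            mul_le_mul h4 h5 (norm_nonneg _) ((norm_nonneg _).trans h4)
        _ = K * C * ((1 + |t|) ^ (1 / 2 : ℝ) * (1 + |t|) ^ (-2 : ℝ)) := by ring
        _ = _ := by rw [← Real.rpow_add ht]; norm_num
    refine h3.norm.mono' ?_ (Filter.Eventually.of_forall fun t => ?_)
    · exact ((continuous_re.comp hFcont).abs.mul hWcont.norm).aestronglyMeasurable
    · rw [norm_mul, norm_mul, norm_norm, Real.norm_eq_abs, abs_abs]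
      gcongr
      exact abs_re_le_norm _
  have hbound := integral_mul_le_of_unit_intervals (g := fun t : ℝ => |(F (σ + t * I)).re|)
    (V := fun t : ℝ => ‖W (σ + t * I)‖) (G := 2100)
    (D := 8 * Real.exp (X * σ) * η ^ (-a)) (P := P) (hθ.trans hσ.le) ha ha1 (by norm_num)
    (by positivity) hP (continuous_re.comp hFcont).abs (fun t => abs_nonneg _) hint
    (fun k => by
      have := integral_abs_re_logDeriv_le (A := fun t => Real.log (P * (4 + |t|))) hL hA h2 hle
        hzero hθ hσ hσ2 k
      simpa only [hF, neg_re, abs_neg] using this)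
    (norm_trapezoidTransform_le hX hη (by linarith) hησ ha.le ha1)
  have hpi : ‖(2 * Real.pi : ℂ)‖ = 2 * Real.pi := by
    simp [abs_of_pos Real.pi_pos]
  rw [hpi] at hshift
  have hpi3 := Real.pi_gt_three
  nlinarith [norm_nonneg (∑' n : ℕ, f n * trapezoid X η (Real.log n))]

end DirichletCharacter

lemma exp_mul_rpow_le {x θ ℓ : ℝ} (hx : 1 ≤ x) (hℓ : 1 ≤ ℓ) (hxℓ : Real.log x ≤ ℓ) :
    Real.exp (Real.log x * (θ + 1 / ℓ)) * (1 / (2 * √x)) ^ (-(1 / ℓ)) ≤ 27 * x ^ θ := by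
  have hx0 : 0 < x := by linarith
  have hs : 0 < √x := Real.sqrt_pos.mpr hx0
  have hℓ0 : 0 < ℓ := by linarith
  have hX : 0 ≤ Real.log x := Real.log_nonneg hx
  have hlog : Real.log (1 / (2 * √x)) = -(Real.log 2 + Real.log x / 2) := by
    rw [one_div, Real.log_inv, Real.log_mul (by norm_num) hs.ne', Real.log_sqrt hx0.le]
  have h2 : Real.log 2 ≤ 1 := by linarith [Real.log_two_lt_d9]
  rw [Real.rpow_def_of_pos (by positivity), Real.rpow_def_of_pos hx0, hlog, ← Real.exp_add]
  have hle : Real.log x * (θ + 1 / ℓ) + -(Real.log 2 + Real.log x / 2) * -(1 / ℓ) ≤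
      3 + Real.log x * θ := by
    have h3 : Real.log x * (1 / ℓ) ≤ 1 := by rw [mul_one_div, div_le_one hℓ0]; exact hxℓ
    have h4 : Real.log 2 * (1 / ℓ) ≤ 1 := by rw [mul_one_div, div_le_one hℓ0]; linarith
    linarith
  refine (Real.exp_le_exp.mpr hle).trans ?_
  rw [Real.exp_add]
  gcongr
  calc Real.exp 3 = Real.exp 1 ^ 3 := by rw [← Real.exp_nat_mul]; norm_num
    _ ≤ 3 ^ 3 := by
      have := Real.exp_one_lt_d9
      gcongr
      linarith
    _ = 27 := by norm_num

/-- (Conditional bound for `ψ(x,χ)`.)  Fix `ε` with `0 ≤ ε < 1/2`.  There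
is an absolute constant `C > 0` such that: for every prime `p` and every nontrivial
Dirichlet character `χ` modulo `p`, if every zero `s` of `L(s,χ)` with `0 < Re s < 1`
satisfies `Re s ≤ 1/2 + ε`, then for all real `x ≥ 2`,
`|ψ(x,χ)| ≤ C · x^(1/2+ε) · (log (p·x))²`, where `ψ(x,χ) = ∑_{n ≤ x} Λ(n)·χ(n)`. -/
theorem psi_chi_bound_of_weak_GRH (ε : ℝ) (hε0 : 0 ≤ ε) (hε : ε < 1 / 2) :
    ∃ C : ℝ, 0 < C ∧
      ∀ (p : ℕ) (hp : p.Prime) (χ : DirichletCharacter ℂ p), χ ≠ 1 →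
        (∀ s : ℂ, @DirichletCharacter.LFunction p ⟨hp.ne_zero⟩ χ s = 0 →
          0 < s.re → s.re < 1 → s.re ≤ 1 / 2 + ε) →
        ∀ x : ℝ, 2 ≤ x →
          ‖∑ n ∈ Finset.Iic ⌊x⌋₊,
              (ArithmeticFunction.vonMangoldt n : ℂ) * χ (n : ZMod p)‖ ≤
            C * x ^ (1 / 2 + ε) * Real.log (p * x) ^ 2 := by
  obtain ⟨B, hB, hgrowth⟩ := exists_LFunction_growth
  have hB5 : 0 ≤ Real.log (5 * B) := Real.log_nonneg (by linarith)
  refine ⟨4 * 16 * 2100 * 8 * 27 * 3 * (Real.log (5 * B) + 3) + 4, by positivity,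
    fun p hp χ hχ hz x hx => ?_⟩
  have : NeZero p := ⟨hp.ne_zero⟩
  set ℓ := Real.log (p * x) with hℓ
  have hx0 : 0 < x := by linarith
  have hp2 : (2 : ℝ) ≤ p := by exact_mod_cast hp.two_le
  have hs1 : 1 ≤ √x := Real.one_le_sqrt.mpr (by linarith)
  have hX0 : 0 ≤ Real.log x := Real.log_nonneg (by linarith)
  have hℓ1 : 1 ≤ ℓ := by
    rw [hℓ, Real.le_log_iff_exp_le (by positivity)]
    have := Real.exp_one_lt_d9
    nlinarith
  have hℓ0 : 0 < ℓ := by linarith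
  have hℓX : ℓ = Real.log p + Real.log x := Real.log_mul (by positivity) hx0.ne'
  have hlogp : 0 ≤ Real.log p := Real.log_nonneg (by linarith)
  have ha1 : 1 / ℓ ≤ 1 := by rw [div_le_one hℓ0]; exact hℓ1
  have ha0 : 0 < 1 / ℓ := by positivity
  have hη2 : 1 / (2 * √x) ≤ 1 / 2 := one_div_le_one_div_of_le (by norm_num) (by linarith)
  have hzero : ∀ s : ℂ, 1 / 5 < s.re → DirichletCharacter.LFunction χ s = 0 →
      s.re ≤ 1 / 2 + ε := by
    intro s hs h0
    refine hz s h0 (by linarith) (lt_of_not_ge fun h1 => ?_)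
    exact DirichletCharacter.LFunction_ne_zero_of_one_le_re χ (.inl hχ) h1 h0
  have hsmooth := DirichletCharacter.norm_tsum_trapezoid_le (P := B * p) (θ := 1 / 2 + ε) (σ := 1 / 2 + ε + 1 / ℓ)
    (a := 1 / ℓ) (X := Real.log x) (η := 1 / (2 * √x)) hχ (by nlinarith)
    (hgrowth p χ hχ) hzero (by linarith) (by linarith) (by linarith) hX0 (by positivity)
    (by nlinarith) ha0 ha1
  have hcut := norm_sum_le_norm_tsum_trapezoid_add
    (f := fun n => (ArithmeticFunction.vonMangoldt n : ℂ) * χ (n : ZMod p)) (fun n => by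
      rw [norm_mul, norm_real, Real.norm_of_nonneg ArithmeticFunction.vonMangoldt_nonneg]
      exact mul_le_of_le_one_right ArithmeticFunction.vonMangoldt_nonneg (χ.norm_le_one _)) hx
  have hmain : 4 * (16 * 2100 * (8 * Real.exp (Real.log x * (1 / 2 + ε + 1 / ℓ)) *
      (1 / (2 * √x)) ^ (-(1 / ℓ))) * (Real.log (5 * (B * p)) + 2 / (1 / ℓ)) * (1 + 2 / (1 / ℓ))) ≤
      4 * 16 * 2100 * 8 * 27 * 3 * (Real.log (5 * B) + 3) * x ^ (1 / 2 + ε) * ℓ ^ 2 := by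
    have h1 := exp_mul_rpow_le (θ := 1 / 2 + ε) (by linarith : 1 ≤ x) hℓ1 (by linarith)
    have h2 : Real.log (5 * (B * p)) + 2 / (1 / ℓ) ≤ (Real.log (5 * B) + 3) * ℓ := by
      rw [← mul_assoc, Real.log_mul (by positivity) (by positivity), div_div_eq_mul_div, div_one]
      nlinarith
    have h3 : 1 + 2 / (1 / ℓ) ≤ 3 * ℓ := by
      rw [div_div_eq_mul_div, div_one]
      linarith
    have h4 : 0 ≤ Real.log (5 * (B * p)) := Real.log_nonneg (by nlinarith)
    calc _ = 4 * 16 * 2100 * 8 * (Real.exp (Real.log x * (1 / 2 + ε + 1 / ℓ)) *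
          (1 / (2 * √x)) ^ (-(1 / ℓ))) * (Real.log (5 * (B * p)) + 2 / (1 / ℓ)) *
          (1 + 2 / (1 / ℓ)) := by ring
      _ ≤ 4 * 16 * 2100 * 8 * (27 * x ^ (1 / 2 + ε)) * ((Real.log (5 * B) + 3) * ℓ) *
          (3 * ℓ) := by gcongr
      _ = _ := by ring
  have htail : (√x + 1) * (Real.log x + 1) ≤ 4 * x ^ (1 / 2 + ε) * ℓ ^ 2 := by
    have h1 : √x ≤ x ^ (1 / 2 + ε) := by
      rw [Real.sqrt_eq_rpow]
      exact Real.rpow_le_rpow_of_exponent_le (by linarith) (by linarith)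
    calc _ ≤ (2 * x ^ (1 / 2 + ε)) * (2 * ℓ) := by gcongr <;> linarith
      _ = 4 * x ^ (1 / 2 + ε) * (ℓ * 1) := by ring
      _ ≤ 4 * x ^ (1 / 2 + ε) * (ℓ * ℓ) := by gcongr
      _ = _ := by ring
  calc _ ≤ _ := hcut
    _ ≤ _ := add_le_add (hsmooth.trans hmain) htail
    _ = _ := by ring
end
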